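/- Let D be a division ring with center F, G a subnormal subgroup of D*, and M a non-abelian maximal subgroup of G. Then M is not finitely generated solvable-by-finite; in particular, M is not polycyclic-by-finite. -/

import Mathlib

/-- A subgroup `H` of a group is subnormal if there is a finite chain of subgroups
from `H` up to the whole group, each normal in the next. -/
def IsSubnormal {Γ : Type*} [Group Γ] (H : Subgroup Γ) : Prop :=
  ∃ (k : ℕ) (s : ℕ → Subgroup Γ), s 0 = H ∧ s k = ⊤ ∧
    ∀ i < k, s i ≤ s (i + 1) ∧ ((s i).subgroupOf (s (i + 1))).Normal

/-- A group is polycyclic if it has a finite subnormal series with cyclic factors: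
each term is normal in the next and the next is generated by the previous term
together with a single element. -/
def IsPolycyclic (Γ : Type*) [Group Γ] : Prop :=
  ∃ (k : ℕ) (s : ℕ → Subgroup Γ), s 0 = ⊥ ∧ s k = ⊤ ∧
    ∀ i < k, s i ≤ s (i + 1) ∧ ((s i).subgroupOf (s (i + 1))).Normal ∧
      ∃ g ∈ s (i + 1), ∀ x ∈ s (i + 1), ∃ m : ℤ, x * (g ^ m)⁻¹ ∈ s i

/-- A group is solvable-by-finite (resp. polycyclic-by-finite) if it has a solvable
(resp. polycyclic) normal subgroup of finite index. -/
def IsSolvableByFinite (Γ : Type*) [Group Γ] : Prop :=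
  ∃ N : Subgroup Γ, N.Normal ∧ IsSolvable ↥N ∧ Finite (Γ ⧸ N)

def IsPolycyclicByFinite (Γ : Type*) [Group Γ] : Prop :=
  ∃ N : Subgroup Γ, N.Normal ∧ IsPolycyclic ↥N ∧ Finite (Γ ⧸ N)


namespace DM
open Polynomial

theorem cbh {D : Type*} [DivisionRing D] (L : Subfield D) {f g h x : D} (hf : f ∈ L) (hg : g ∈ L)
    (hh : h ∈ L) (hx : x ∉ L) (h1 : g * x = x * f) (h2 : h * (1 + x) = (1 + x) * f) :
    x * f = f * x := by
  have e : (h - g) * x = f - h := by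
    rw [sub_mul, h1]
    have : h + h * x = f + x * f := by simpa [mul_add, add_mul] using h2
    have h3 : h * x = f + x * f - h := by rw [← this]; abel
    rw [h3]; abel
  by_cases hgh : h - g = 0
  · rw [hgh, zero_mul] at e
    have e1 : f = h := sub_eq_zero.mp e.symm
    have e2 : h = g := sub_eq_zero.mp hgh
    rw [← h1, e1, e2]
  · exfalso
    apply hx
    have : x = (h - g)⁻¹ * (f - h) := by rw [← e, inv_mul_cancel_left₀ hgh]
    rw [this]
    exact L.mul_mem (L.inv_mem (L.sub_mem hh hg)) (L.sub_mem hf hh)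

theorem grp_lem {A : Type*} [CommGroup A] (τ : A →* A) (d : ℕ) (m : ℕ) :
    ∀ f : A, τ^[d] f = f → (fun f => f / τ f)^[m + 1] f = 1 → (f / τ f) ^ (d ^ m) = 1 := by
  have key : ∀ (n : ℕ) (f : A), ∏ i ∈ Finset.range n, τ^[i] (f / τ f) = f / τ^[n] f := by
    intro n f
    induction n with
    | zero => simp
    | succ n ih =>
      rw [Finset.prod_range_succ, ih, iterate_map_div, ← Function.iterate_succ_apply]
      simp
  induction m with
  | zero => intro f _ h; simpa using h
  | succ m ih =>
    intro f hd h
    rw [Function.iterate_succ_apply] at h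
    have h1 := ih (f / τ f) (by rw [iterate_map_div, ← Function.iterate_succ_apply, Function.iterate_succ_apply', hd]) h
    set w := (f / τ f) ^ (d ^ m) with hw
    have hfix : τ w = w := by
      rw [div_pow, ← map_pow, ← hw] at h1
      exact (div_eq_one.mp h1).symm
    have hw2 : w = (f ^ (d ^ m)) / τ (f ^ (d ^ m)) := by rw [hw, div_pow, map_pow]
    have h3 := key d (f ^ (d ^ m))
    rw [← hw2, iterate_map_pow, hd, div_self'] at h3
    have h4 : ∀ i, τ^[i] w = w := fun i => Function.iterate_fixed hfix i
    simp only [h4, Finset.prod_const, Finset.card_range] at h3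
    rw [pow_succ, pow_mul, ← hw, h3]

/-- numerators and denominators -/
noncomputable def PQ {E : Type*} [Field E] (τ : E →+* E) (v : E) : ℕ → E[X] × E[X]
  | 0 => (X + C v, 1)
  | n + 1 => ((PQ τ v n).1 * (PQ τ v n).2.map τ, (PQ τ v n).2 * (PQ τ v n).1.map τ)

theorem qfield {E : Type*} [Field E] (τ : E →+* E) (v c : E) (hv : v ≠ 0) (hc : τ c = c)
    (hvc : τ v = c * v) (hinf : {s : E | τ s = s}.Infinite) (m : ℕ)
    (hm : ∀ f : Eˣ, (fun f => f / Units.map (τ : E →* E) f)^[m] f = 1) : c = 1 := by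
  by_contra hc1
  have hc0 : c ≠ 0 := by
    rintro rfl
    rw [zero_mul] at hvc
    exact hv (by simpa using hvc)
  have hit : ∀ j, τ^[j] v = c ^ j * v := by
    intro j
    induction j with
    | zero => simp
    | succ j ih => rw [Function.iterate_succ_apply', ih, map_mul, map_pow, hc, hvc]; ring
  have hinf' : ({s : E | τ s = s} \ {-v}).Infinite := hinf.sdiff (Set.finite_singleton _)
  by_cases hord : ∃ d, 0 < d ∧ c ^ d = 1
  · obtain ⟨d, hd, hcd⟩ := hord
    have hm1 : ∀ f : Eˣ, (fun f => f / Units.map (τ : E →* E) f)^[m + 1] f = 1 := by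
      intro f; rw [Function.iterate_succ_apply]; exact hm _
    set e := d ^ m with he
    have he0 : e ≠ 0 := by positivity
    have hs : ∀ s ∈ ({s : E | τ s = s} \ {-v}), (s + v) ^ e = (s + c * v) ^ e := by
      rintro s ⟨hs, hsv⟩
      have hs : τ s = s := hs
      have hne : s + v ≠ 0 := fun h => hsv (by simpa using eq_neg_of_add_eq_zero_left h)
      have := grp_lem (Units.map (τ : E →* E)) d m (Units.mk0 _ hne) ?_ (hm1 _)
      · rw [div_pow, div_eq_one, ← he] at this
        have := congrArg Units.val this
        simpa [hs, hvc] using this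
      · have aux : ∀ (j : ℕ) (f : Eˣ), (((Units.map (τ : E →* E))^[j] f : Eˣ) : E) = τ^[j] (f : E) := by
          intro j f
          induction j with
          | zero => rfl
          | succ j ih => rw [Function.iterate_succ_apply', Function.iterate_succ_apply', ← ih]; rfl
        ext
        rw [aux]
        simp [iterate_map_add, hit, hcd, Function.iterate_fixed hs]
    have hpoly : ((X + C v) ^ e : E[X]) = (X + C (c * v)) ^ e := by
      apply Polynomial.eq_of_infinite_eval_eq
      refine hinf'.mono ?_
      intro s hs'
      simpa using hs s hs'
    have := congrArg (Polynomial.eval (-v)) hpoly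
    have this : 0 = (-v + c * v) ^ e := by simpa [he0] using this
    have this : -v + c * v = 0 := eq_zero_of_pow_eq_zero this.symm
    have h3 : (c - 1) * v = 0 := by rw [← this]; ring
    rcases mul_eq_zero.mp h3 with h | h
    · exact hc1 (sub_eq_zero.mp h)
    · exact hv h
  · push Not at hord
    have ev : ∀ (P : E[X]) (s : E), τ s = s → (P.map τ).eval s = τ (P.eval s) := by
      intro P s hs
      conv_lhs => rw [← hs]
      rw [Polynomial.eval_map, Polynomial.eval₂_hom]
    have hf : ∀ (s : E) (hne : s + v ≠ 0), τ s = s → ∀ n,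
        (((fun f => f / Units.map (τ : E →* E) f)^[n] (Units.mk0 _ hne) : Eˣ) : E)
          = (PQ τ v n).1.eval s / (PQ τ v n).2.eval s := by
      intro s hne hs n
      induction n with
      | zero => simp [PQ]
      | succ n ih =>
        rw [Function.iterate_succ_apply']
        simp only [Units.val_div_eq_div_val, Units.coe_map, MonoidHom.coe_coe, PQ, eval_mul, ev _ s hs]
        rw [ih, map_div₀, div_div_div_eq]
    have hPQ : (PQ τ v m).1 = (PQ τ v m).2 := by
      apply Polynomial.eq_of_infinite_eval_eq
      refine hinf'.mono ?_
      rintro s ⟨hs, hsv⟩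
      have hs : τ s = s := hs
      have hne : s + v ≠ 0 := fun h => hsv (by simpa using eq_neg_of_add_eq_zero_left h)
      have := hf s hne hs m
      rw [hm] at this
      exact eq_of_div_eq_one this.symm
    have h0 : ∀ n, (PQ τ v n).1.eval (-v) = 0 := by
      intro n
      induction n with
      | zero => simp [PQ]
      | succ n ih => simp [PQ, ih]
    have hX : ∀ j, (Polynomial.mapRingHom τ)^[j] (X + C v) = X + C (c ^ j * v) := by
      intro j
      rw [← hit]
      induction j with
      | zero => simp
      | succ j ih => rw [Function.iterate_succ_apply', ih, Function.iterate_succ_apply']; simp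
    have h1 : ∀ n, (∀ j, ((Polynomial.mapRingHom τ)^[j] (PQ τ v n).2).eval (-v) ≠ 0) ∧
        (∀ j, ((Polynomial.mapRingHom τ)^[j + 1] (PQ τ v n).1).eval (-v) ≠ 0) := by
      intro n
      induction n with
      | zero =>
        refine ⟨fun j => by
          have : (PQ τ v 0).2 = 1 := rfl
          rw [this, iterate_map_one]; simp, fun j => ?_⟩
        have : (PQ τ v 0).1 = X + C v := rfl
        rw [this, hX]
        simp only [eval_add, eval_X, eval_C]
        intro h
        have h3 : (c ^ (j + 1) - 1) * v = 0 := by rw [← h]; ring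
        rcases mul_eq_zero.mp h3 with h | h
        · exact hord (j + 1) (by omega) (sub_eq_zero.mp h)
        · exact hv h
      | succ n ih =>
        have e1 : (PQ τ v (n+1)).1 = (PQ τ v n).1 * Polynomial.mapRingHom τ (PQ τ v n).2 := rfl
        have e2 : (PQ τ v (n+1)).2 = (PQ τ v n).2 * Polynomial.mapRingHom τ (PQ τ v n).1 := rfl
        constructor
        · intro j
          rw [e2, iterate_map_mul, eval_mul, ← Function.iterate_succ_apply]
          exact mul_ne_zero (ih.1 j) (ih.2 j)
        · intro j
          rw [e1, iterate_map_mul, eval_mul, ← Function.iterate_succ_apply]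
          exact mul_ne_zero (ih.2 j) (ih.1 _)
    have := (h1 m).1 0
    rw [← hPQ] at this
    exact this (h0 m)

end DM


namespace DM
open scoped Pointwise

/-- centralizer as a division subring -/
def cent {D : Type*} [DivisionRing D] (S : Set D) : Subfield D where
  carrier := {x | ∀ s ∈ S, s * x = x * s}
  mul_mem' := by
    intro a b ha hb s hs
    rw [← mul_assoc, ha s hs, mul_assoc, hb s hs, mul_assoc]
  one_mem' := by intro s _; simp
  add_mem' := by
    intro a b ha hb s hs
    rw [mul_add, add_mul, ha s hs, hb s hs]
  zero_mem' := by intro s _; simp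
  neg_mem' := by
    intro a ha s hs
    rw [mul_neg, neg_mul, ha s hs]
  inv_mem' := by
    intro a ha s hs
    have : Commute s a := ha s hs
    exact this.inv_right₀

theorem mem_cent {D : Type*} [DivisionRing D] {S : Set D} {x : D} :
    x ∈ cent S ↔ ∀ s ∈ S, s * x = x * s := Iff.rfl

theorem comm_closure {D : Type*} [DivisionRing D] {S : Set D}
    (h : ∀ x ∈ S, ∀ y ∈ S, x * y = y * x) :
    ∀ x ∈ Subfield.closure S, ∀ y ∈ Subfield.closure S, x * y = y * x := by
  have h1 : Subfield.closure S ≤ cent S := Subfield.closure_le.mpr (fun x hx y hy => h y hy x hx)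
  have h2 : Subfield.closure S ≤ cent (Subfield.closure S : Set D) :=
    Subfield.closure_le.mpr (fun x hx y hy => (h1 hy x hx).symm)
  intro x hx y hy
  exact (h2 hy) x hx

/-- subnormal of depth at most n -/
def SN {Γ : Type*} [Group Γ] : ℕ → Subgroup Γ → Prop
  | 0, H => H = ⊤
  | n + 1, H => ∃ K, SN n K ∧ H ≤ K ∧ ∀ k ∈ K, ∀ h ∈ H, k * h * k⁻¹ ∈ H

theorem sn_comm {Γ : Type*} [Group Γ] : ∀ (n : ℕ) (B : Subgroup Γ), SN n B → ∀ u ∈ B, ∀ f : Γ,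
    (fun f => f / (u * f * u⁻¹))^[n] f ∈ B
  | 0, B, h, u, _, f => by rw [show B = ⊤ from h]; trivial
  | n + 1, B, ⟨K, hK, hBK, hN⟩, u, hu, f => by
    rw [Function.iterate_succ_apply']
    have h1 := sn_comm n K hK u (hBK hu) f
    set b := (fun f => f / (u * f * u⁻¹))^[n] f
    have : b / (u * b * u⁻¹) = (b * u * b⁻¹) * u⁻¹ := by rw [div_eq_mul_inv]; group
    show b / (u * b * u⁻¹) ∈ B
    rw [this]
    exact B.mul_mem (hN b h1 u hu) (B.inv_mem hu)

/-- conjugation as a ring hom -/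
def conjHom {D : Type*} [DivisionRing D] (u : Dˣ) : D →+* D where
  toFun x := u * x * (u⁻¹ : Dˣ)
  map_one' := by simp
  map_mul' x y := by simp [mul_assoc]
  map_zero' := by simp
  map_add' x y := by simp [mul_add, add_mul]

theorem lemQ0 {D : Type*} [DivisionRing D] (n : ℕ) (B : Subgroup Dˣ) (hB : SN n B) (u v c : Dˣ)
    (hu : u ∈ B) (h : ∀ b ∈ B, Commute (b * u * b⁻¹) u)
    (hc : u * v * u⁻¹ = c * v) (hcu : Commute c u) (hcv : Commute c v)
    (hinf : {s : D | s ∈ Subfield.closure ({(c : D), (v : D)} : Set D) ∧ (u : D) * s = s * u}.Infinite) :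
    c = 1 := by
  set S : Set D := {(c : D), (v : D)} with hS
  set E := Subfield.closure S with hE
  have hcv' : (c : D) * v = v * c := by exact_mod_cast congrArg Units.val hcv.eq
  have hcomm : ∀ x ∈ E, ∀ y ∈ E, x * y = y * x := by
    apply comm_closure
    rintro x (rfl | rfl) y (rfl | rfl) <;> simp [hcv']
  let _ : Field E := { (inferInstance : DivisionRing E) with
    mul_comm := fun a b => Subtype.ext (hcomm a a.2 b b.2) }
  have hcE : (c : D) ∈ E := Subfield.subset_closure (by simp [hS])
  have hvE : (v : D) ∈ E := Subfield.subset_closure (by simp [hS])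
  have hc' : (u : D) * c * (u⁻¹ : Dˣ) = c := by
    have : u * c * u⁻¹ = c := by rw [← hcu.eq]; group
    exact_mod_cast congrArg Units.val this
  have hv' : (u : D) * v * (u⁻¹ : Dˣ) = c * v := by exact_mod_cast congrArg Units.val hc
  have hmap : E ≤ E.comap (conjHom u) := by
    apply Subfield.closure_le.mpr
    rintro x (rfl | rfl)
    · show (u : D) * c * (u⁻¹ : Dˣ) ∈ E
      rw [hc']; exact hcE
    · show (u : D) * v * (u⁻¹ : Dˣ) ∈ E
      rw [hv']; exact E.mul_mem hcE hvE
  let τ : E →+* E := ((conjHom u).comp E.subtype).codRestrict E (fun x => hmap x.2)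
  have hτ : ∀ x : E, ((τ x : E) : D) = u * x * (u⁻¹ : Dˣ) := fun x => rfl
  let ι : Eˣ →* Dˣ := Units.map (E.subtype : E →* D)
  have hι : ∀ f : Eˣ, ι (Units.map (τ : E →* E) f) = u * ι f * u⁻¹ := by
    intro f
    ext
    simp [ι, hτ]
  have hιinj : Function.Injective ι := by
    intro a b hab
    have := congrArg Units.val hab
    ext
    exact this
  have hit : ∀ j (f : Eˣ), ι ((fun f => f / Units.map (τ : E →* E) f)^[j] f)
      = (fun f => f / (u * f * u⁻¹))^[j] (ι f) := by
    intro j f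
    induction j with
    | zero => rfl
    | succ j ih =>
      rw [Function.iterate_succ_apply', Function.iterate_succ_apply', ← ih, map_div, hι]
  have := qfield τ ⟨v, hvE⟩ ⟨c, hcE⟩ (by
      intro h0; exact v.ne_zero (congrArg Subtype.val h0)) (Subtype.ext hc') (Subtype.ext hv') ?_ (n + 2) ?_
  · ext
    exact congrArg Subtype.val this
  · have hfun : Set.Infinite ((Subtype.val : E → D) '' {s | τ s = s}) := by
      refine hinf.mono ?_
      rintro s ⟨hs, hs2⟩
      refine ⟨⟨s, hs⟩, ?_, rfl⟩
      apply Subtype.ext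
      rw [hτ]
      show (u : D) * s * (u⁻¹ : Dˣ) = s
      rw [hs2]; simp
    exact hfun.of_image _
  · intro f
    apply hιinj
    rw [hit, map_one, Function.iterate_succ_apply', Function.iterate_succ_apply']
    have hb := sn_comm n B hB u hu (ι f)
    set b := (fun f => f / (u * f * u⁻¹))^[n] (ι f)
    have h1 : b / (u * b * u⁻¹) = (b * u * b⁻¹) * u⁻¹ := by rw [div_eq_mul_inv]; group
    have h2 : Commute ((b * u * b⁻¹) * u⁻¹) u := (h b hb).mul_left (Commute.refl u).inv_left
    show (b / (u * b * u⁻¹)) / (u * (b / (u * b * u⁻¹)) * u⁻¹) = 1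
    rw [h1, ← h2.eq, div_eq_mul_inv]
    group

theorem zpow_rel {Γ : Type*} [Group Γ] {u v c : Γ} (hc : u * v * u⁻¹ = c * v) (hcv : Commute c v)
    (k : ℤ) : u * v ^ k * u⁻¹ = c ^ k * v ^ k := by
  rw [← hcv.mul_zpow, ← hc, conj_zpow]

theorem lemQ1 {D : Type*} [DivisionRing D] (n : ℕ) (B : Subgroup Dˣ) (hB : SN n B) (u v c : Dˣ)
    (hu : u ∈ B) (h : ∀ b ∈ B, Commute (b * u * b⁻¹) u)
    (hc : u * v * u⁻¹ = c * v) (hcu : Commute c u) (hcv : Commute c v)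
    (hinf : CharZero D ∨ ¬ IsOfFinOrder c ∨ ¬ IsOfFinOrder v) :
    c = 1 := by
  have hcE : (c : D) ∈ Subfield.closure ({(c : D), (v : D)} : Set D) :=
    Subfield.subset_closure (by simp)
  have hvE : (v : D) ∈ Subfield.closure ({(c : D), (v : D)} : Set D) :=
    Subfield.subset_closure (by simp)
  apply lemQ0 n B hB u v c hu h hc hcu hcv
  have aux : ∀ w : Dˣ, (w : D) ∈ Subfield.closure ({(c : D), (v : D)} : Set D) → Commute u w →
      ¬ IsOfFinOrder w →
      {s : D | s ∈ Subfield.closure ({(c : D), (v : D)} : Set D) ∧ (u : D) * s = s * u}.Infinite := by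
    intro w hw huw hfin
    rw [← injective_pow_iff_not_isOfFinOrder] at hfin
    have hinj : Function.Injective (fun k : ℕ => ((w ^ k : Dˣ) : D)) :=
      fun a b hab => hfin (Units.ext hab)
    refine (Set.infinite_range_of_injective hinj).mono ?_
    rintro _ ⟨k, rfl⟩
    refine ⟨by simpa using Subfield.pow_mem _ hw k, ?_⟩
    show (u : D) * ((w ^ k : Dˣ) : D) = ((w ^ k : Dˣ) : D) * u
    exact_mod_cast congrArg Units.val (huw.pow_right k).eq
  by_cases hcf : IsOfFinOrder c
  swap
  · exact aux c hcE hcu.symm hcf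
  rcases hinf with h0 | h1 | h1
  · refine (Set.infinite_range_of_injective (Nat.cast_injective (R := D))).mono ?_
    rintro _ ⟨k, rfl⟩
    exact ⟨natCast_mem _ k, (Nat.cast_commute k (u : D)).eq.symm⟩
  · exact absurd hcf h1
  · obtain ⟨d, hd, hcd⟩ := isOfFinOrder_iff_pow_eq_one.mp hcf
    refine aux (v ^ d) (by simpa using Subfield.pow_mem _ hvE d) ?_ (fun h => h1 ?_)
    · have := zpow_rel hc hcv d
      simp only [zpow_natCast, hcd, one_mul] at this
      exact mul_inv_eq_iff_eq_mul.mp this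
    · exact (isOfFinOrder_pow.mp h).resolve_right hd.ne'

theorem lemQ {D : Type*} [DivisionRing D] (n : ℕ) (B : Subgroup Dˣ) (hB : SN n B) (u v : Dˣ)
    (hu : u ∈ B) (hv : v ∈ B) (h : ∀ b ∈ B, Commute (b * u * b⁻¹) u)
    (h' : ∀ b ∈ B, Commute (b * v * b⁻¹) v) : Commute u v := by
  set c := u * v * u⁻¹ * v⁻¹ with hcdef
  have hc : u * v * u⁻¹ = c * v := by rw [hcdef]; group
  have hcv : Commute c v := (h' u hu).mul_left (Commute.refl v).inv_left
  have hcu : Commute c u := by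
    have : c = u * (v * u * v⁻¹)⁻¹ := by rw [hcdef]; group
    rw [this]
    exact (Commute.refl u).mul_left (h v hv).inv_left
  have hc' : v * u * v⁻¹ = c⁻¹ * u := by rw [hcdef]; group
  suffices c = 1 by
    rw [this, one_mul] at hc
    exact mul_inv_eq_iff_eq_mul.mp hc
  by_cases h1 : CharZero D ∨ ¬ IsOfFinOrder c ∨ ¬ IsOfFinOrder v
  · exact lemQ1 n B hB u v c hu h hc hcu hcv h1
  by_cases h2 : CharZero D ∨ ¬ IsOfFinOrder c⁻¹ ∨ ¬ IsOfFinOrder u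
  · exact inv_eq_one.mp (lemQ1 n B hB v u c⁻¹ hv h' hc' hcv.inv_left hcu.inv_left h2)
  push Not at h1 h2
  obtain ⟨hch, hcf, hvf⟩ := h1
  obtain ⟨-, -, huf⟩ := h2
  obtain ⟨p, hp⟩ := CharP.exists D
  have hp0 : p ≠ 0 := by
    rintro rfl
    exact hch (CharP.charP_to_charZero D)
  have : NeZero p := ⟨hp0⟩
  have : Fact p.Prime := ⟨(CharP.char_is_prime_or_zero D p).resolve_right hp0⟩
  let _ : Algebra (ZMod p) D := ZMod.algebra D p
  let R := Algebra.adjoin (ZMod p) ({(u : D), (v : D)} : Set D)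
  let T : Set D := (fun t : ℤ × ℤ × ℤ => ((u ^ t.1 * v ^ t.2.1 * c ^ t.2.2 : Dˣ) : D)) '' Set.univ
  have hT : T.Finite := by
    have hf : ((Subgroup.zpowers u : Set Dˣ) * (Subgroup.zpowers v : Set Dˣ) * (Subgroup.zpowers c : Set Dˣ)).Finite :=
      ((finite_zpowers.mpr huf).mul (finite_zpowers.mpr hvf)).mul (finite_zpowers.mpr hcf)
    refine (hf.image (Units.val)).subset ?_
    rintro _ ⟨⟨i, j, k⟩, -, rfl⟩
    exact ⟨_, Set.mul_mem_mul (Set.mul_mem_mul ⟨i, rfl⟩ ⟨j, rfl⟩) ⟨k, rfl⟩, rfl⟩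
  have hsub : (Submonoid.closure ({(u : D), (v : D)} : Set D) : Set D) ⊆ T := by
    intro x hx
    induction hx using Submonoid.closure_induction_right with
    | one => exact ⟨(0, 0, 0), trivial, by simp⟩
    | mul_right x hx y hy ih =>
      obtain ⟨⟨i, j, k⟩, -, rfl⟩ := ih
      rcases hy with rfl | rfl
      · refine ⟨(i + 1, j, k - j), trivial, ?_⟩
        simp only
        rw [← Units.val_mul]
        congr 1
        have h5 := zpow_rel hc hcv j
        have h6 : u * v ^ j * u⁻¹ = v ^ j * c ^ j := by
          rw [h5]; exact ((hcv.zpow_left j).zpow_right j).eq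
        have h7 : v ^ j * u = u * v ^ j * c ^ (-j) := by
          have : u * v ^ j = v ^ j * c ^ j * u := mul_inv_eq_iff_eq_mul.mp h6
          rw [this, mul_assoc, (hcu.zpow_left (-j)).eq.symm, ← mul_assoc]
          simp
        rw [mul_assoc _ _ u, (hcu.zpow_left k).eq, ← mul_assoc, mul_assoc _ _ u, h7, zpow_add, zpow_sub]
        have h8 : c ^ (-j) * c ^ k = c ^ k * (c ^ j)⁻¹ := by
          rw [← zpow_neg, ← zpow_add, ← zpow_add, add_comm]
        simp only [zpow_one, mul_assoc, h8]
      · refine ⟨(i, j + 1, k), trivial, ?_⟩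
        simp only
        rw [← Units.val_mul]
        congr 1
        rw [mul_assoc _ _ v, (hcv.zpow_left k).eq, zpow_add, zpow_one]
        simp only [mul_assoc]
  have hRfin : Finite R := by
    have hfd : Module.Finite (ZMod p) (Submodule.span (ZMod p) (Submonoid.closure ({(u : D), (v : D)} : Set D) : Set D)) :=
      Module.Finite.span_of_finite _ (hT.subset hsub)
    have : Finite (Submodule.span (ZMod p) (Submonoid.closure ({(u : D), (v : D)} : Set D) : Set D)) :=
      Module.finite_of_finite (ZMod p)
    rw [← Algebra.adjoin_eq_span] at this
    exact this
  have hfield := Finite.isDomain_to_isField R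
  have := hfield.mul_comm ⟨u, Algebra.subset_adjoin (by simp)⟩ ⟨v, Algebra.subset_adjoin (by simp)⟩
  have h9 : (u : D) * v = v * u := congrArg Subtype.val this
  have h10 : u * v = v * u := Units.ext h9
  rw [hcdef, h10]; group

end DM


namespace DM
open scoped commutatorElement
set_option linter.unusedVariables false

section grp
variable {Γ : Type*} [Group Γ]

theorem sn_succ : ∀ {n : ℕ} {H : Subgroup Γ}, SN n H → SN (n + 1) H :=
  fun {n H} h => ⟨H, h, le_rfl, fun k hk x hx => H.mul_mem (H.mul_mem hk hx) (H.inv_mem hk)⟩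

theorem sn_comap {Γ' : Type*} [Group Γ'] (f : Γ' →* Γ) : ∀ {n : ℕ} {H : Subgroup Γ}, SN n H → SN n (H.comap f)
  | 0, H, h => by rw [show H = ⊤ from h]; rfl
  | n + 1, H, ⟨K, hK, hHK, hN⟩ =>
    ⟨K.comap f, sn_comap f hK, Subgroup.comap_mono hHK, fun k hk h hh => by
      have := hN (f k) hk (f h) hh
      simpa using this⟩

theorem sn_inf {n : ℕ} {H : Subgroup Γ} (hH : SN n H) : ∀ {m : ℕ} {K : Subgroup Γ}, SN m K → SN (n + m) (H ⊓ K)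
  | 0, K, h => by rw [show K = ⊤ from h]; simpa using hH
  | m + 1, K, ⟨K', hK', hle, hN⟩ =>
    ⟨H ⊓ K', sn_inf hH hK', inf_le_inf_left _ hle, fun k hk h hh =>
      ⟨H.mul_mem (H.mul_mem hk.1 hh.1) (H.inv_mem hk.1), hN k hk.2 h hh.2⟩⟩

theorem sn_iInf {ι : Type*} : ∀ {n : ℕ} {H : ι → Subgroup Γ}, (∀ i, SN n (H i)) → SN n (⨅ i, H i)
  | 0, H, h => by
    have : ∀ i, H i = ⊤ := h
    show (⨅ i, H i) = ⊤
    simp [this]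
  | n + 1, H, h => by
    choose K hK hle hN using h
    refine ⟨⨅ i, K i, sn_iInf hK, iInf_mono hle, fun k hk x hx => ?_⟩
    rw [Subgroup.mem_iInf] at *
    exact fun i => hN i k (hk i) x (hx i)

/-- iterated commutator subgroups -/
def iterD (N : Subgroup Γ) : ℕ → Subgroup Γ
  | 0 => N
  | n + 1 => ⁅iterD N n, iterD N n⁆

theorem comm_le_self (N : Subgroup Γ) : ⁅N, N⁆ ≤ N :=
  Subgroup.commutator_le.mpr fun a ha b hb =>
    N.mul_mem (N.mul_mem (N.mul_mem ha hb) (N.inv_mem ha)) (N.inv_mem hb)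

theorem conj_comm_mem {N K : Subgroup Γ} (h : ∀ k ∈ K, ∀ h ∈ N, k * h * k⁻¹ ∈ N) :
    ∀ k ∈ K, ∀ h ∈ ⁅N, N⁆, k * h * k⁻¹ ∈ ⁅N, N⁆ := by
  intro k hk x hx
  have : ⁅N, N⁆ ≤ (⁅N, N⁆).comap (MulAut.conj k).toMonoidHom := by
    apply Subgroup.commutator_le.mpr
    intro a ha b hb
    show k * ⁅a, b⁆ * k⁻¹ ∈ ⁅N, N⁆
    have : k * ⁅a, b⁆ * k⁻¹ = ⁅k * a * k⁻¹, k * b * k⁻¹⁆ := by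
      simp only [commutatorElement_def]; group
    rw [this]
    exact Subgroup.commutator_mem_commutator (h k hk a ha) (h k hk b hb)
  exact this hx

theorem self_conj (N : Subgroup Γ) : ∀ k ∈ N, ∀ h ∈ N, k * h * k⁻¹ ∈ N :=
  fun _ hk _ hx => N.mul_mem (N.mul_mem hk hx) (N.inv_mem hk)

theorem conj_iterD_mem {N K : Subgroup Γ} (h : ∀ k ∈ K, ∀ h ∈ N, k * h * k⁻¹ ∈ N) (n : ℕ) :
    ∀ k ∈ K, ∀ h ∈ iterD N n, k * h * k⁻¹ ∈ iterD N n := by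
  induction n with
  | zero => exact h
  | succ n ih => exact conj_comm_mem ih

theorem iterD_le (N : Subgroup Γ) (n : ℕ) : iterD N n ≤ N := by
  induction n with
  | zero => exact le_rfl
  | succ n ih => exact (comm_le_self _).trans ih

theorem iterD_mono {N K : Subgroup Γ} (h : N ≤ K) (n : ℕ) : iterD N n ≤ iterD K n := by
  induction n with
  | zero => exact h
  | succ n ih => exact Subgroup.commutator_mono ih ih

theorem sn_comm_sub {n : ℕ} {H : Subgroup Γ} (h : SN n H) : SN (n + 1) ⁅H, H⁆ :=
  ⟨H, h, comm_le_self H, conj_comm_mem (self_conj H)⟩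

theorem sn_iterD {k : ℕ} {H : Subgroup Γ} (h : SN k H) (n : ℕ) : SN (k + n) (iterD H n) := by
  induction n with
  | zero => exact h
  | succ n ih => exact sn_comm_sub ih

theorem sn_of_isSubnormal_aux : ∀ (k : ℕ) (s : ℕ → Subgroup Γ), s k = ⊤ →
    (∀ i < k, s i ≤ s (i + 1) ∧ ((s i).subgroupOf (s (i + 1))).Normal) → SN k (s 0)
  | 0, s, h, _ => h
  | k + 1, s, h, hN => by
    refine ⟨s 1, sn_of_isSubnormal_aux k (fun i => s (i + 1)) h (fun i hi => hN (i + 1) (by omega)),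
      (hN 0 (by omega)).1, fun a ha b hb => ?_⟩
    have := (hN 0 (by omega)).2.conj_mem ⟨b, (hN 0 (by omega)).1 hb⟩ hb ⟨a, ha⟩
    exact this

/-- conjugate subgroup -/
def cj (x : Γ) (H : Subgroup Γ) : Subgroup Γ := H.comap (MulAut.conj x).toMonoidHom

theorem mem_cj {x y : Γ} {H : Subgroup Γ} : y ∈ cj x H ↔ x * y * x⁻¹ ∈ H := Iff.rfl

theorem sn_cj {n : ℕ} {H : Subgroup Γ} (x : Γ) (h : SN n H) : SN n (cj x H) := sn_comap _ h

theorem grp_closure_comm {S : Set Γ} (h : ∀ x ∈ S, ∀ y ∈ S, x * y = y * x) :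
    ∀ x ∈ Subgroup.closure S, ∀ y ∈ Subgroup.closure S, x * y = y * x := by
  have h1 : Subgroup.closure S ≤ Subgroup.centralizer S :=
    (Subgroup.closure_le _).mpr (fun x hx => Subgroup.mem_centralizer_iff.mpr fun y hy => h y hy x hx)
  have h2 : Subgroup.closure S ≤ Subgroup.centralizer (Subgroup.closure S : Set Γ) :=
    (Subgroup.closure_le _).mpr (fun x hx => Subgroup.mem_centralizer_iff.mpr
      fun y hy => (Subgroup.mem_centralizer_iff.mp (h1 hy) x hx).symm)
  intro x hx y hy
  exact Subgroup.mem_centralizer_iff.mp (h2 hy) x hx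

end grp

variable {D : Type*} [DivisionRing D]

/-- the units of a subgroup as a set in `D` -/
def us (H : Subgroup Dˣ) : Set D := Units.val '' (H : Set Dˣ)

theorem mem_us {H : Subgroup Dˣ} {h : Dˣ} (hh : h ∈ H) : (h : D) ∈ us H := ⟨h, hh, rfl⟩

theorem val_comm {a b : Dˣ} (h : a * b = b * a) : (a : D) * b = b * a := by
  exact_mod_cast congrArg Units.val h

theorem ucomm {a b : Dˣ} (h : (a : D) * b = b * a) : a * b = b * a := Units.ext h

theorem us_comm {X : Subgroup Dˣ} (h : ∀ x ∈ X, ∀ y ∈ X, x * y = y * x) :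
    ∀ x ∈ Subfield.closure (us X), ∀ y ∈ Subfield.closure (us X), x * y = y * x := by
  apply comm_closure
  rintro _ ⟨x, hx, rfl⟩ _ ⟨y, hy, rfl⟩
  exact val_comm (h x hx y hy)

theorem cbh_units (L : Subfield D) {w x y : Dˣ} (hy : (y : D) = 1 + x) (h0 : (w : D) ∈ L)
    (h1 : ((x * w * x⁻¹ : Dˣ) : D) ∈ L) (h2 : ((y * w * y⁻¹ : Dˣ) : D) ∈ L) (hx : (x : D) ∉ L) :
    x * w = w * x := by
  apply ucomm
  refine cbh L h0 h1 h2 hx ?_ ?_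
  · simp
  · rw [← hy]; simp

theorem exists_one_add (L : Subfield D) {x : D} (hx : x ∉ L) : ∃ a b : Dˣ, (a : D) = x ∧ (b : D) = 1 + x := by
  have h0 : x ≠ 0 := by rintro rfl; exact hx L.zero_mem
  have h1 : 1 + x ≠ 0 := by
    intro h
    have : x = -1 := by rw [← add_right_inj (1 : D), h]; simp
    exact hx (this ▸ L.neg_mem L.one_mem)
  exact ⟨Units.mk0 x h0, Units.mk0 _ h1, rfl, rfl⟩

theorem SA : ∀ (n : ℕ) (X : Subgroup Dˣ), SN n X → (∀ x ∈ X, ∀ y ∈ X, x * y = y * x) →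
    X ≤ Subgroup.center Dˣ
  | 0, X, h, hc => by
    rw [show X = ⊤ from h] at hc ⊢
    intro x hx
    exact Subgroup.mem_center_iff.mpr fun y => hc y trivial x hx
  | 1, X, ⟨U, hU, hXU, hN⟩, hc => by
    have hU : U = ⊤ := hU
    subst hU
    intro x hx
    refine Subgroup.mem_center_iff.mpr fun y => ?_
    have hx' : (x : D) ∈ Subfield.closure (us X) := Subfield.subset_closure (mem_us hx)
    by_cases hy : (y : D) ∈ Subfield.closure (us X)
    · exact ucomm (us_comm hc _ hy _ hx')
    · obtain ⟨a, b, ha, hb⟩ := exists_one_add _ hy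
      refine cbh_units _ (y := b) hb hx' ?_ ?_ hy
      · exact Subfield.subset_closure (mem_us (hN y trivial x hx))
      · exact Subfield.subset_closure (mem_us (hN b trivial x hx))
  | n + 2, X, ⟨U, ⟨Q, hQ, hUQ, hN'⟩, hXU, hN⟩, hc => by
    have hUsn : SN (n + 1) U := ⟨Q, hQ, hUQ, hN'⟩
    have hle : ∀ q ∈ Q, cj q X ≤ U := by
      intro q hq y hy
      have := hN' q⁻¹ (Q.inv_mem hq) _ (hXU (mem_cj.mp hy))
      have e : q⁻¹ * (q * y * q⁻¹) * q⁻¹⁻¹ = y := by group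
      rwa [e] at this
    have hnq : ∀ q ∈ Q, ∀ u ∈ U, ∀ y ∈ cj q X, u * y * u⁻¹ ∈ cj q X := by
      intro q hq u hu y hy
      rw [mem_cj] at *
      have := hN (q * u * q⁻¹) (hN' q hq u hu) _ hy
      have e : q * u * q⁻¹ * (q * y * q⁻¹) * (q * u * q⁻¹)⁻¹ = q * (u * y * u⁻¹) * q⁻¹ := by group
      rwa [e] at this
    have hcq : ∀ q, ∀ x ∈ cj q X, ∀ y ∈ cj q X, x * y = y * x := by
      intro q x hx y hy
      have := hc _ hx _ hy
      simp only [MulEquiv.toMonoidHom_eq_coe, MonoidHom.coe_coe, ← map_mul] at this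
      exact (MulAut.conj q).injective this
    have key : ∀ q ∈ Q, ∀ x ∈ X, ∀ y ∈ cj q X, x * y = y * x := by
      intro q hq x hx y hy
      have hBU : X ⊔ cj q X ≤ U := sup_le hXU (hle q hq)
      have hB : SN (n + 2) (X ⊔ cj q X) := by
        refine ⟨U, hUsn, hBU, fun u hu b hb => ?_⟩
        have : X ⊔ cj q X ≤ cj u (X ⊔ cj q X) := by
          refine sup_le (fun a ha => ?_) (fun a ha => ?_)
          · exact Subgroup.mem_sup_left (hN u hu a ha)
          · exact Subgroup.mem_sup_right (hnq q hq u hu a ha)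
        exact this hb
      exact lemQ (n + 2) (X ⊔ cj q X) hB x y (Subgroup.mem_sup_left hx) (Subgroup.mem_sup_right hy)
        (fun b hb => hc _ (hN b (hBU hb) x hx) _ hx)
        (fun b hb => hcq q _ (hnq q hq b (hBU hb) y hy) _ hy)
    let S : Set Dˣ := {y | ∃ q ∈ Q, y ∈ cj q X}
    have hScomm : ∀ x ∈ S, ∀ y ∈ S, x * y = y * x := by
      rintro x ⟨q, hq, hx⟩ y ⟨r, hr, hy⟩
      have h1 : q * y * q⁻¹ ∈ cj (r * q⁻¹) X := by
        rw [mem_cj] at *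
        have e : r * q⁻¹ * (q * y * q⁻¹) * (r * q⁻¹)⁻¹ = r * y * r⁻¹ := by group
        rwa [e]
      have := key (r * q⁻¹) (Q.mul_mem hr (Q.inv_mem hq)) _ hx _ h1
      have h2 : (MulAut.conj q) x * (MulAut.conj q) y = (MulAut.conj q) y * (MulAut.conj q) x := this
      simp only [← map_mul] at h2
      exact (MulAut.conj q).injective h2
    have hY : SN (n + 1) (Subgroup.closure S) := by
      refine ⟨Q, hQ, (Subgroup.closure_le _).mpr ?_, ?_⟩
      · rintro x ⟨q, hq, hx⟩
        exact hUQ (hle q hq hx)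
      · intro k hk h hh
        have : Subgroup.closure S ≤ cj k (Subgroup.closure S) := by
          apply (Subgroup.closure_le _).mpr
          rintro x ⟨q, hq, hx⟩
          apply Subgroup.subset_closure
          refine ⟨q * k⁻¹, Q.mul_mem hq (Q.inv_mem hk), ?_⟩
          rw [mem_cj] at *
          have e : q * k⁻¹ * (k * x * k⁻¹) * (q * k⁻¹)⁻¹ = q * x * q⁻¹ := by group
          simpa [mul_assoc] using hx
        exact this hh
    have := SA (n + 1) _ hY (grp_closure_comm hScomm)
    refine le_trans ?_ this
    intro x hx
    exact Subgroup.subset_closure ⟨1, Q.one_mem, by simpa [mem_cj] using hx⟩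

theorem center_of_comm_central {n : ℕ} {N : Subgroup Dˣ} (h : SN n N)
    (hc : ⁅N, N⁆ ≤ Subgroup.center Dˣ) : N ≤ Subgroup.center Dˣ := by
  apply SA n N h
  have : ∀ x ∈ N, ∀ b ∈ N, Commute (b * x * b⁻¹) x := by
    intro x hx b hb
    have h1 : b * x * b⁻¹ * x⁻¹ ∈ Subgroup.center Dˣ := hc (Subgroup.commutator_mem_commutator hb hx)
    have h2 : Commute x (b * x * b⁻¹ * x⁻¹) := Subgroup.mem_center_iff.mp h1 x
    have h3 := h2.mul_right (Commute.refl x)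
    simpa using h3.symm
  intro x hx y hy
  exact lemQ n N h x y hx hy (this x hx) (this y hy)

theorem Sol {n : ℕ} {N : Subgroup Dˣ} (h : SN n N) (k : ℕ) (hk : iterD N k ≤ Subgroup.center Dˣ) :
    N ≤ Subgroup.center Dˣ := by
  induction k with
  | zero => exact hk
  | succ k ih => exact ih (center_of_comm_central (sn_iterD h k) hk)

theorem beta {n : ℕ} {H : Subgroup Dˣ} (hH : SN n H) (L : Subfield D) (hL : ∀ h ∈ H, (h : D) ∈ L)
    {h : Dˣ} (hh : h ∈ H) (hnc : h ∉ Subgroup.center Dˣ) {x : D} (hx : (h : D) * x = x * h) : x ∈ L := by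
  by_contra hxL
  let W : Subgroup Dˣ := ⨅ c : {c : Dˣ // c * h = h * c}, cj c.1 H
  have hW : SN n W := sn_iInf fun c => sn_cj _ hH
  have hWmem : ∀ w, w ∈ W ↔ ∀ c : Dˣ, c * h = h * c → c * w * c⁻¹ ∈ H := by
    intro w
    simp only [W, Subgroup.mem_iInf, mem_cj, Subtype.forall]
  have key : ∀ x : D, x ∉ L → (h : D) * x = x * h → ∀ w ∈ W, x * (w : D) = w * x := by
    intro x hxL hx w hw
    obtain ⟨a, b, ha, hb⟩ := exists_one_add _ hxL
    rw [hWmem] at hw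
    rw [← ha] at hx hb hxL ⊢
    apply val_comm
    refine cbh_units L hb ?_ ?_ ?_ hxL
    · simpa using hL _ (hw 1 (by simp))
    · exact hL _ (hw a (ucomm hx.symm))
    · refine hL _ (hw b (ucomm ?_))
      rw [hb, mul_add, add_mul, hx]; simp
  have key2 : ∀ c : D, (h : D) * c = c * h → ∀ w ∈ W, c * (w : D) = w * c := by
    intro c hc w hw
    by_cases hcL : c ∈ L
    · have h1 := key (c + x) (fun h => hxL (by simpa using L.sub_mem h hcL)) (by rw [mul_add, add_mul, hc, hx]) w hw
      have h2 := key x hxL hx w hw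
      rw [mul_add, add_mul, h2] at h1
      exact add_right_cancel h1
    · exact key c hcL hc w hw
  have hhW : h ∈ W := by
    rw [hWmem]; intro c hc; rw [hc]; simpa using hh
  have hWc : ∀ x ∈ W, ∀ y ∈ W, x * y = y * x := by
    intro x hx y hy
    apply ucomm
    apply key2 _ (key2 h rfl x hx) y hy
  exact hnc (SA n W hW hWc hhW)

theorem exists_noncentral {H : Subgroup Dˣ} (h : ¬ H ≤ Subgroup.center Dˣ) :
    ∃ x ∈ H, x ∉ Subgroup.center Dˣ := SetLike.not_le_iff_exists.mp h

theorem Acomm {n : ℕ} {H : Subgroup Dˣ} (hH : SN n H) (hnc : ¬ H ≤ Subgroup.center Dˣ) (x y : D)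
    (hx : ∀ h ∈ H, (h : D) * x = x * h) (hy : ∀ h ∈ H, (h : D) * y = y * h) : x * y = y * x := by
  obtain ⟨h, hh, hhc⟩ := exists_noncentral hnc
  have h1 : x ∈ Subfield.closure (us H) :=
    beta hH _ (fun h hh => Subfield.subset_closure (mem_us hh)) hh hhc (hx h hh)
  have h2 : Subfield.closure (us H) ≤ cent {y} := Subfield.closure_le.mpr (by
    rintro _ ⟨h, hh, rfl⟩ z (rfl : z = y)
    exact (hy h hh).symm)
  exact (h2 h1 y rfl).symm

end DM


namespace DM
open scoped commutatorElement
set_option linter.unusedVariables false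

variable {D : Type*} [DivisionRing D]

theorem bigAux {Γ : Type*} [Group Γ] (B Y : Subgroup Γ) (hBY : ∀ b ∈ B, ∀ y ∈ Y, b * y * b⁻¹ ∈ Y) :
    ∀ (k : ℕ) (B' : Subgroup Γ), SN k B' → B ≤ B' →
    (∃ j, ∀ e ∈ iterD B j, ∀ y ∈ Y ⊓ B', e * y = y * e) → ∃ j, ∀ e ∈ iterD B j, ∀ y ∈ Y, e * y = y * e
  | 0, B', h, hB, ⟨j, hj⟩ => by
    rw [show B' = ⊤ from h] at hj
    exact ⟨j, fun e he y hy => hj e he y ⟨hy, trivial⟩⟩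
  | k + 1, B', ⟨K, hK, hB'K, hN⟩, hB, ⟨j, hj⟩ => by
    refine bigAux B Y hBY k K hK (hB.trans hB'K) ⟨j + 1, ?_⟩
    intro e he y hy
    have hV : ∀ e ∈ iterD B j, e * y * e⁻¹ * y⁻¹ ∈ Y ⊓ B' := by
      intro e he
      have heB := iterD_le B j he
      refine ⟨Y.mul_mem (hBY e heB y hy.1) (Y.inv_mem hy.1), ?_⟩
      have h1 := hN y hy.2 _ (hB (B.inv_mem heB))
      have := B'.mul_mem (hB heB) h1
      simpa [mul_assoc] using this
    have hVn : ∀ v ∈ Y ⊓ B', y⁻¹ * v * y ∈ Y ⊓ B' := by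
      intro v hv
      refine ⟨Y.mul_mem (Y.mul_mem (Y.inv_mem hy.1) hv.1) hy.1, ?_⟩
      simpa using hN y⁻¹ (K.inv_mem hy.2) v hv.2
    have hZ : ∀ e ∈ iterD B j, ∀ v ∈ Y ⊓ B', (e * y * e⁻¹ * y⁻¹) * v = v * (e * y * e⁻¹ * y⁻¹) := by
      intro e he v hv
      have h1 := hj _ ((iterD B j).inv_mem he) _ (hVn v hv)
      have h2 := hj e he v hv
      calc (e * y * e⁻¹ * y⁻¹) * v = e * y * (e⁻¹ * (y⁻¹ * v * y)) * y⁻¹ := by group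
        _ = (e * v) * y * e⁻¹ * y⁻¹ := by rw [h1]; group
        _ = _ := by rw [h2]; group
    have hgen : ∀ e₁ ∈ iterD B j, ∀ e₂ ∈ iterD B j, ⁅e₁, e₂⁆ * y = y * ⁅e₁, e₂⁆ := by
      intro a ha b hb
      have h1 : ∀ a ∈ iterD B j, ∀ b ∈ iterD B j, (a * b) * y * (a * b)⁻¹ =
          (b * y * b⁻¹ * y⁻¹) * (a * y * a⁻¹ * y⁻¹) * y := by
        intro a ha b hb
        have := hj a ha _ (hV b hb)
        calc (a * b) * y * (a * b)⁻¹ = (a * (b * y * b⁻¹ * y⁻¹)) * y * a⁻¹ := by group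
          _ = _ := by rw [this]; group
      set w := (b * y * b⁻¹ * y⁻¹) * (a * y * a⁻¹ * y⁻¹) with hw
      have hwV : w ∈ Y ⊓ B' := Subgroup.mul_mem _ (hV b hb) (hV a ha)
      have e1 := h1 a ha b hb
      have e2 := h1 b hb a ha
      rw [← hZ b hb _ (hV a ha), ← hw] at e2
      have hc : ⁅a, b⁆ ∈ iterD B j :=
        comm_le_self _ (Subgroup.commutator_mem_commutator ha hb)
      have e3 := hj _ hc w hwV
      have e4 : ⁅a, b⁆ * (w * y) * ⁅a, b⁆⁻¹ = w * y := by
        have e7 : ⁅a, b⁆ * ((b * a) * y * (b * a)⁻¹) * ⁅a, b⁆⁻¹ = (a * b) * y * (a * b)⁻¹ := by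
          simp only [commutatorElement_def]; group
        rw [← e2, e7, e1, e2]
      have e5 : w * (⁅a, b⁆ * y * ⁅a, b⁆⁻¹) = w * y := by
        rw [← e4, ← mul_assoc ⁅a, b⁆ w y, e3]; group
      have e6 := mul_left_cancel e5
      exact mul_inv_eq_iff_eq_mul.mp e6
    have : iterD B (j + 1) ≤ Subgroup.centralizer {y} := Subgroup.commutator_le.mpr fun a ha b hb => by
      rw [Subgroup.mem_centralizer_singleton_iff]
      first | exact hgen a ha b hb | exact (hgen a ha b hb).symm
    have := Subgroup.mem_centralizer_singleton_iff.mp (this he)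
    first | exact this | exact this.symm

theorem big {n : ℕ} {X : Subgroup Dˣ} (hX : SN n X) (hXc : ¬ X ≤ Subgroup.center Dˣ) :
    ∀ {m : ℕ} {Y : Subgroup Dˣ}, SN m Y → ¬ Y ≤ Subgroup.center Dˣ → ¬ X ⊓ Y ≤ Subgroup.center Dˣ
  | 0, Y, h, _ => by rw [show Y = ⊤ from h]; simpa using hXc
  | m + 1, Y, ⟨K, hK, hYK, hN⟩, hYc => by
    intro hcon
    have hYsn : SN (m + 1) Y := ⟨K, hK, hYK, hN⟩
    have hKc : ¬ K ≤ Subgroup.center Dˣ := fun h => hYc (hYK.trans h)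
    have hB := big hX hXc hK hKc
    have hBsn := sn_inf hX hK
    obtain ⟨j, hj⟩ := bigAux (X ⊓ K) Y (fun b hb y hy => hN b hb.2 y hy) _ (X ⊓ K) hBsn le_rfl
      ⟨0, fun e he y hy => Subgroup.mem_center_iff.mp (hcon ⟨hy.2.1, hy.1⟩) e⟩
    apply hB
    apply Sol hBsn (j + 1)
    apply Subgroup.commutator_le.mpr
    intro a ha b hb
    have : a * b = b * a := by
      apply ucomm
      apply Acomm hYsn hYc
      · exact fun y hy => (val_comm (hj a ha y hy)).symm
      · exact fun y hy => (val_comm (hj b hb y hy)).symm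
    rw [commutatorElement_eq_one_iff_mul_comm.mpr this]
    exact Subgroup.one_mem _

theorem cj_noncentral {H : Subgroup Dˣ} (x : Dˣ) (h : ¬ H ≤ Subgroup.center Dˣ) :
    ¬ cj x H ≤ Subgroup.center Dˣ := by
  intro hc
  apply h
  intro y hy
  have h1 : x⁻¹ * y * x ∈ cj x H := by
    rw [mem_cj]
    have e : x * (x⁻¹ * y * x) * x⁻¹ = y := by group
    rwa [e]
  have h2 := hc h1
  have := (inferInstance : (Subgroup.center Dˣ).Normal).conj_mem _ h2 x
  have e : x * (x⁻¹ * y * x) * x⁻¹ = y := by group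
  rwa [e] at this

theorem T {n : ℕ} {H : Subgroup Dˣ} (hH : SN n H) (hnc : ¬ H ≤ Subgroup.center Dˣ) (L : Subfield D)
    (hL : ∀ h ∈ H, (h : D) ∈ L) (x : D) : x ∈ L := by
  by_contra hx
  obtain ⟨a, b, rfl, hb⟩ := exists_one_add _ hx
  have h1 := big (sn_inf hH (sn_cj a hH)) (big hH hnc (sn_cj a hH) (cj_noncentral a hnc)) (sn_cj b hH)
    (cj_noncentral b hnc)
  obtain ⟨t, ⟨⟨ht1, ht2⟩, ht3⟩, htc⟩ := exists_noncentral h1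
  have := cbh_units L hb (hL t ht1) (hL _ ht2) (hL _ ht3) hx
  exact hx (beta hH L hL ht1 htc (val_comm this.symm))

theorem T_central {n : ℕ} {H : Subgroup Dˣ} (hH : SN n H) (hnc : ¬ H ≤ Subgroup.center Dˣ) (x : Dˣ)
    (hx : ∀ h ∈ H, x * h = h * x) : x ∈ Subgroup.center Dˣ := by
  refine Subgroup.mem_center_iff.mpr fun y => ?_
  have := T hH hnc (cent {(x : D)}) (by
    rintro h hh s (rfl : s = x)
    exact val_comm (hx h hh)) y
  exact ucomm (this x rfl).symm

theorem central_val {z : Dˣ} (hz : z ∈ Subgroup.center Dˣ) (d : D) : d * z = z * d := by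
  by_cases h : d = 0
  · simp [h]
  · exact val_comm (Subgroup.mem_center_iff.mp hz (Units.mk0 d h))

theorem CF_top (h : (Subgroup.center Dˣ).index ≠ 0) : (⊤ : Subgroup Dˣ) ≤ Subgroup.center Dˣ := by
  have hfin : Finite (Dˣ ⧸ Subgroup.center Dˣ) := Subgroup.index_ne_zero_iff_finite.mp h
  let F : Subfield D := cent Set.univ
  by_cases hF : Finite F
  · have hZ : Finite (Subgroup.center Dˣ) := by
      refine Finite.of_injective (fun z => (⟨z.1, fun s _ => central_val z.2 s⟩ : F)) ?_
      intro a b hab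
      have := congrArg Subtype.val hab
      exact Subtype.ext (Units.ext this)
    have hU : Finite Dˣ := by
      have := Subgroup.groupEquivQuotientProdSubgroup (s := Subgroup.center Dˣ)
      exact Finite.of_equiv _ this.symm
    have hD : Finite D := by
      have : (Set.univ : Set D) ⊆ insert 0 (Set.range (Units.val : Dˣ → D)) := by
        intro d _
        by_cases hd : d = 0
        · exact Or.inl hd
        · exact Or.inr ⟨Units.mk0 d hd, rfl⟩
      exact Set.finite_univ_iff.mp (((Set.finite_range _).insert 0).subset this)
    have hf := Finite.isDomain_to_isField D
    intro x _
    exact Subgroup.mem_center_iff.mpr fun y => ucomm (hf.mul_comm _ _)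
  · intro a _
    by_contra ha
    have hF' : Infinite F := not_finite_iff_infinite.mp hF
    have hne : ∀ s : F, (a : D) + s ≠ 0 := by
      intro s hs
      apply ha
      refine Subgroup.mem_center_iff.mpr fun y => ucomm ?_
      have : (a : D) = -s := eq_neg_of_add_eq_zero_left hs
      rw [this]
      have h2 := s.2 (y : D) trivial
      rw [mul_neg, neg_mul, h2]
    obtain ⟨s, t, hst, heq⟩ := Finite.exists_ne_map_eq_of_infinite
      (fun s : F => (QuotientGroup.mk (Units.mk0 _ (hne s)) : Dˣ ⧸ Subgroup.center Dˣ))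
    rw [QuotientGroup.eq] at heq
    set z := (Units.mk0 _ (hne s))⁻¹ * Units.mk0 _ (hne t) with hz
    have e0 : Units.mk0 _ (hne s) * z = Units.mk0 _ (hne t) := by rw [hz]; group
    have e : ((a : D) + s) * z = a + t := by
      have := congrArg Units.val e0
      simpa using this
    have hzF : (z : D) ∈ F := fun d _ => central_val heq d
    have e1 : (a : D) * (z - 1) = t - s * z := by
      rw [mul_sub, mul_one]
      rw [add_mul] at e
      rw [sub_eq_sub_iff_add_eq_add, e]; abel
    by_cases hz1 : (z : D) - 1 = 0
    · rw [hz1, mul_zero, sub_eq_zero.mp hz1, mul_one] at e1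
      exact hst (Subtype.ext (sub_eq_zero.mp e1.symm).symm)
    · have haF : (a : D) ∈ F := by
        have : (a : D) = (t - s * z) * ((z : D) - 1)⁻¹ := by rw [← e1, mul_inv_cancel_right₀ hz1]
        rw [this]
        exact F.mul_mem (F.sub_mem t.2 (F.mul_mem s.2 hzF)) (F.inv_mem (F.sub_mem hzF F.one_mem))
      exact ha (Subgroup.mem_center_iff.mpr fun y => ucomm (haF y trivial))

theorem fin_cent_index {Γ : Type*} [Group Γ] (Z H K : Subgroup Γ) [hZ : Z.Normal]
    (hN : ∀ k ∈ K, ∀ h ∈ H, k * h * k⁻¹ ∈ H) (hfin : Z.relIndex H ≠ 0) :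
    ∃ Q : Subgroup Γ, Q ≤ K ∧ Q.relIndex K ≠ 0 ∧ ∀ q, q ∈ Q ↔ q ∈ K ∧ ∀ h ∈ H, q * h * q⁻¹ * h⁻¹ ∈ Z := by
  let π := QuotientGroup.mk' Z
  let Hb := H.map π
  have hHb : Finite Hb := by
    have h1 : (H.map π : Set (Γ ⧸ Z)).Finite := by
      have : Nat.card (H.map π) ≠ 0 := by
        rw [← Subgroup.relIndex_ker, QuotientGroup.ker_mk']; exact hfin
      exact Nat.finite_of_card_ne_zero this
    exact h1
  have hKn : K.map π ≤ Subgroup.normalizer (Hb : Set (Γ ⧸ Z)) := by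
    rintro _ ⟨k, hk, rfl⟩
    rw [Subgroup.mem_normalizer_iff]
    intro h
    constructor
    · rintro ⟨x, hx, rfl⟩
      exact ⟨k * x * k⁻¹, hN k hk x hx, by simp⟩
    · rintro ⟨x, hx, hx2⟩
      refine ⟨k⁻¹ * x * k, ?_, ?_⟩
      · simpa using hN k⁻¹ (K.inv_mem hk) x hx
      · simp only [map_mul, hx2, map_inv]; group
  let f : K →* MulAut Hb := (Subgroup.normalizerMonoidHom Hb).comp
    ((Subgroup.inclusion hKn).comp (π.subgroupMap K))
  have hf : ∀ (k : K) (h : Hb), ((f k h : Hb) : Γ ⧸ Z) = π k * h * (π k)⁻¹ := fun k h => rfl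
  refine ⟨f.ker.map K.subtype, ?_, ?_, ?_⟩
  · rintro _ ⟨k, -, rfl⟩; exact k.2
  · have h1 : f.ker.index ≠ 0 := (Subgroup.finiteIndex_ker f).index_ne_zero
    have h2 : (f.ker.map K.subtype).relIndex K = f.ker.index := by
      rw [Subgroup.relIndex, Subgroup.subgroupOf, Subgroup.comap_map_eq_self_of_injective K.subtype_injective]
    rw [h2]; exact h1
  · intro q
    have key : ∀ k : K, k ∈ f.ker ↔ ∀ h ∈ H, (k : Γ) * h * (k : Γ)⁻¹ * h⁻¹ ∈ Z := by
      intro k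
      rw [MonoidHom.mem_ker]
      constructor
      · intro hk h hh
        have := hf k ⟨π h, ⟨h, hh, rfl⟩⟩
        rw [hk] at this
        have h3 : π h = π k * π h * (π k)⁻¹ := this
        have h4 : π ((k : Γ) * h * (k : Γ)⁻¹ * h⁻¹) = 1 := by
          simp only [map_mul, map_inv]; rw [← h3]; simp
        exact (QuotientGroup.eq_one_iff _).mp h4
      · intro hk
        ext ⟨_, h, hh, rfl⟩
        rw [hf]
        have h4 : π ((k : Γ) * h * (k : Γ)⁻¹ * h⁻¹) = 1 := (QuotientGroup.eq_one_iff _).mpr (hk h hh)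
        simp only [map_mul, map_inv] at h4
        exact mul_inv_eq_one.mp h4
    constructor
    · rintro ⟨k, hk, rfl⟩
      exact ⟨k.2, (key k).mp hk⟩
    · rintro ⟨hq, h⟩
      exact ⟨⟨q, hq⟩, (key ⟨q, hq⟩).mpr h, rfl⟩

theorem CF : ∀ (n : ℕ) (H : Subgroup Dˣ), SN n H → (Subgroup.center Dˣ).relIndex H ≠ 0 →
    H ≤ Subgroup.center Dˣ
  | 0, H, h, hi => by
    rw [show H = ⊤ from h] at hi ⊢
    exact CF_top (by simpa using hi)
  | n + 1, H, ⟨K, hK, hHK, hN⟩, hi => by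
    by_contra hnc
    have hHsn : SN (n + 1) H := ⟨K, hK, hHK, hN⟩
    obtain ⟨Q, hQK, hQi, hQ⟩ := fin_cent_index (Subgroup.center Dˣ) H K hN hi
    have hQsn : SN (n + 1) Q := by
      refine ⟨K, hK, hQK, fun k hk q hq => ?_⟩
      rw [hQ] at hq ⊢
      refine ⟨K.mul_mem (K.mul_mem hk hq.1) (K.inv_mem hk), fun h hh => ?_⟩
      have h1 := hq.2 (k⁻¹ * h * k) (by simpa using hN k⁻¹ (K.inv_mem hk) h hh)
      have h2 := (inferInstance : (Subgroup.center Dˣ).Normal).conj_mem _ h1 k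
      convert h2 using 1
      group
    have hQc : ⁅Q, Q⁆ ≤ Subgroup.center Dˣ := by
      apply Subgroup.commutator_le.mpr
      intro a ha b hb
      apply T_central hHsn hnc
      intro h hh
      have h1 := ((hQ a).mp ha).2 h hh
      have h2 := ((hQ b).mp hb).2 h hh
      set z := a * h * a⁻¹ * h⁻¹ with hz
      set w := b * h * b⁻¹ * h⁻¹ with hw
      have ea : a * h = z * h * a := by rw [hz]; group
      have eb : b * h = w * h * b := by rw [hw]; group
      have cz := Subgroup.mem_center_iff.mp h1
      have cw := Subgroup.mem_center_iff.mp h2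
      have e1 : (a * b) * h = (z * w) * h * (a * b) := by
        calc (a * b) * h = a * (b * h) := by group
          _ = (a * w) * h * b := by rw [eb]; group
          _ = w * (a * h) * b := by rw [cw a]; group
          _ = (w * z) * h * (a * b) := by rw [ea]; group
          _ = _ := by rw [cw z]
      have e2 : (b * a) * h = (z * w) * h * (b * a) := by
        calc (b * a) * h = b * (a * h) := by group
          _ = (b * z) * h * a := by rw [ea]; group
          _ = z * (b * h) * a := by rw [cz b]; group
          _ = (z * w) * h * (b * a) := by rw [eb]; group
      have e3 : ⁅a, b⁆ * (b * a) = a * b := by simp only [commutatorElement_def]; group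
      have e4 : ⁅a, b⁆ * h * (b * a) * (z * w) = h * ⁅a, b⁆ * (b * a) * (z * w) := by
        have c1 : ∀ g, g * (z * w) = (z * w) * g := Subgroup.mem_center_iff.mp (Subgroup.mul_mem _ h1 h2)
        calc ⁅a, b⁆ * h * (b * a) * (z * w) = ⁅a, b⁆ * ((h * (b * a)) * (z * w)) := by group
          _ = ⁅a, b⁆ * ((b * a) * h) := by rw [c1, e2]; group
          _ = (⁅a, b⁆ * (b * a)) * h := by group
          _ = (z * w) * (h * (a * b)) := by rw [e3, e1]; group
          _ = (h * (⁅a, b⁆ * (b * a))) * (z * w) := by rw [← c1, e3]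
          _ = _ := by group
      exact mul_right_cancel (mul_right_cancel e4)
    have hQZ := center_of_comm_central hQsn hQc
    have hKZ := CF n K hK (fun h0 => hQi (by
      have := Subgroup.relIndex_dvd_of_le_left K hQZ
      rw [h0] at this
      exact zero_dvd_iff.mp this))
    exact hnc (hHK.trans hKZ)

theorem S2 {n : ℕ} {H N : Subgroup Dˣ} (hH : SN n H) (hNH : N ≤ H)
    (hN : ∀ k ∈ H, ∀ h ∈ N, k * h * k⁻¹ ∈ N) (k : ℕ) (hk : iterD N k ≤ Subgroup.center Dˣ)
    (hi : N.relIndex H ≠ 0) : H ≤ Subgroup.center Dˣ := by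
  have hNsn : SN (n + 1) N := ⟨H, hH, hNH, hN⟩
  have hNZ := Sol hNsn k hk
  apply CF n H hH
  intro h0
  have := Subgroup.relIndex_dvd_of_le_left H hNZ
  rw [h0] at this
  exact hi (zero_dvd_iff.mp this)

end DM


namespace DM
open scoped commutatorElement
set_option linter.unusedVariables false

variable {D : Type*} [DivisionRing D]

/-- the standing assumptions -/
structure Setup (G M N : Subgroup Dˣ) (n s : ℕ) : Prop where
  sn : SN n G
  le : M ≤ G
  ne : M ≠ G
  max : ∀ H : Subgroup Dˣ, M ≤ H → H ≤ G → H = M ∨ H = G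
  NM : N ≤ M
  Nn : ∀ m ∈ M, ∀ x ∈ N, m * x * m⁻¹ ∈ N
  sol : iterD N s = ⊥
  ind : N.relIndex M ≠ 0
  nonab : ¬ ∀ x ∈ M, ∀ y ∈ M, x * y = y * x

/-- units of a subfield lying in `G` -/
def unitsIn (L : Subfield D) (G : Subgroup Dˣ) : Subgroup Dˣ where
  carrier := {g | g ∈ G ∧ (g : D) ∈ L}
  mul_mem' := fun ha hb => ⟨G.mul_mem ha.1 hb.1, by simpa using L.mul_mem ha.2 hb.2⟩
  one_mem' := ⟨G.one_mem, by simp⟩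
  inv_mem' := fun ha => ⟨G.inv_mem ha.1, by simpa using L.inv_mem ha.2⟩

theorem mem_unitsIn {L : Subfield D} {G : Subgroup Dˣ} {g : Dˣ} :
    g ∈ unitsIn L G ↔ g ∈ G ∧ (g : D) ∈ L := Iff.rfl

/-- elements of `G` normalising `L` -/
def normIn (L : Subfield D) (G : Subgroup Dˣ) : Subgroup Dˣ where
  carrier := {g | g ∈ G ∧ ∀ x : D, x ∈ L ↔ (g : D) * x * (g⁻¹ : Dˣ) ∈ L}
  mul_mem' := by
    rintro a b ⟨ha, ha'⟩ ⟨hb, hb'⟩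
    refine ⟨G.mul_mem ha hb, fun x => ?_⟩
    rw [hb' x, ha' _]
    simp [mul_assoc]
  one_mem' := ⟨G.one_mem, fun x => by simp⟩
  inv_mem' := by
    rintro a ⟨ha, ha'⟩
    refine ⟨G.inv_mem ha, fun x => ?_⟩
    rw [ha' (((a⁻¹ : Dˣ) : D) * x * ((a⁻¹⁻¹ : Dˣ) : D))]
    simp [mul_assoc]

theorem iterD_comap_le {Γ Γ' : Type*} [Group Γ] [Group Γ'] (f : Γ' →* Γ) (N : Subgroup Γ) (k : ℕ) :
    iterD (N.comap f) k ≤ (iterD N k).comap f := by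
  induction k with
  | zero => exact le_rfl
  | succ k ih =>
    apply Subgroup.commutator_le.mpr
    intro a ha b hb
    show f ⁅a, b⁆ ∈ iterD N (k + 1)
    rw [map_commutatorElement]
    exact Subgroup.commutator_mem_commutator (ih ha) (ih hb)

variable {G M N : Subgroup Dˣ} {n s : ℕ}

theorem Setup.V (S : Setup G M N n s) (L : Subfield D)
    (hL : ∀ m ∈ M, ∀ x ∈ L, (m : D) * x * (m⁻¹ : Dˣ) ∈ L) :
    (∀ x, x ∈ L) ∨ (∀ g ∈ G, (g : D) ∈ L → g ∈ Subgroup.center Dˣ) ∨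
      (∀ g ∈ G, (g : D) ∈ L → g ∈ M ∧ ∀ x ∈ L, g * x = x * g) := by
  have hM : M ≤ normIn L G := by
    intro m hm
    refine ⟨S.le hm, fun x => ⟨hL m hm x, fun h => ?_⟩⟩
    have := hL m⁻¹ (M.inv_mem hm) _ h
    simpa [mul_assoc] using this
  have hG : normIn L G ≤ G := fun g hg => hg.1
  rcases S.max _ hM hG with h | h
  · right; right
    have hLM : unitsIn L G ≤ M := by
      rw [← h]
      rintro g ⟨hg, hgL⟩
      have hg' : ((g⁻¹ : Dˣ) : D) ∈ L := by simpa using L.inv_mem hgL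
      refine ⟨hg, fun x => ⟨fun hx => L.mul_mem (L.mul_mem hgL hx) hg', fun hx => ?_⟩⟩
      have := L.mul_mem (L.mul_mem hg' hx) hgL
      simpa [mul_assoc] using this
    let f : Lˣ →* Dˣ := Units.map (L.subtype : L →* D)
    have hinj : Function.Injective f := by
      intro a b hab
      have := congrArg Units.val hab
      ext
      exact this
    have hmap : (G.comap f).map f = unitsIn L G := by
      ext g
      constructor
      · rintro ⟨x, hx, rfl⟩
        exact ⟨hx, (x : L).2⟩
      · rintro ⟨hg, hgL⟩
        refine ⟨Units.mk0 ⟨g, hgL⟩ (fun h0 => g.ne_zero (congrArg Subtype.val h0)), ?_, ?_⟩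
        · show f _ ∈ G
          convert hg
          ext; rfl
        · ext; rfl
    have hH : (unitsIn L G).comap f ≤ Subgroup.center Lˣ := by
      have e : (unitsIn L G).comap f = G.comap f := by
        rw [← hmap, Subgroup.comap_map_eq_self_of_injective hinj]
      rw [e]
      have hUM : ∀ k ∈ G.comap f, f k ∈ M := by
        intro k hk
        exact hLM ⟨hk, (k : L).2⟩
      apply S2 (N := N.comap f) (sn_comap f S.sn) (Subgroup.comap_mono (S.NM.trans S.le)) ?_ s ?_ ?_
      · intro k hk x hx
        have := S.Nn (f k) (hUM k hk) (f x) hx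
        show f (k * x * k⁻¹) ∈ N
        simpa using this
      · refine (iterD_comap_le f N s).trans ?_
        rw [S.sol]
        intro x hx
        have : f x = 1 := hx
        have : x = 1 := hinj (by rw [this, map_one])
        rw [this]; exact Subgroup.one_mem _
      · rw [Subgroup.relIndex_comap, hmap]
        intro h0
        exact S.ind (Subgroup.relIndex_eq_zero_of_le_right hLM h0)
    intro g hg hgL
    refine ⟨hLM ⟨hg, hgL⟩, fun x hx => ?_⟩
    have hg' : g ∈ (G.comap f).map f := by rw [hmap]; exact ⟨hg, hgL⟩
    obtain ⟨k, hk, rfl⟩ := hg'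
    have := central_val (hH (show k ∈ (unitsIn L G).comap f from ⟨hk, (k : L).2⟩)) (⟨x, hx⟩ : L)
    exact (congrArg Subtype.val this).symm
  · by_cases hc : unitsIn L G ≤ Subgroup.center Dˣ
    · right; left
      exact fun g hg hgL => hc ⟨hg, hgL⟩
    · left
      have hsn : SN (n + 1) (unitsIn L G) := by
        refine ⟨G, S.sn, fun g hg => hg.1, fun k hk g hg => ?_⟩
        refine ⟨G.mul_mem (G.mul_mem hk hg.1) (G.inv_mem hk), ?_⟩
        rw [← h] at hk
        have := (hk.2 g).mp hg.2
        simpa using this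
      exact T hsn hc L (fun h hh => hh.2)

theorem conj_closure {H : Subgroup Dˣ} (m : Dˣ) (hm : ∀ h ∈ H, m * h * m⁻¹ ∈ H) :
    ∀ x ∈ Subfield.closure (us H), (m : D) * x * (m⁻¹ : Dˣ) ∈ Subfield.closure (us H) := by
  have : Subfield.closure (us H) ≤ (Subfield.closure (us H)).comap (conjHom m) := by
    apply Subfield.closure_le.mpr
    rintro _ ⟨h, hh, rfl⟩
    apply Subfield.subset_closure
    exact ⟨_, hm h hh, by simp [conjHom]⟩
  exact fun x hx => this hx

theorem Setup.gen (S : Setup G M N n s) (H : Subgroup Dˣ) (hHM : H ≤ M)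
    (hn : ∀ m ∈ M, ∀ h ∈ H, m * h * m⁻¹ ∈ H) (hna : ¬ ∀ x ∈ H, ∀ y ∈ H, x * y = y * x) :
    ∀ x, x ∈ Subfield.closure (us H) := by
  have hsub : ∀ h ∈ H, (h : D) ∈ Subfield.closure (us H) := fun h hh => Subfield.subset_closure (mem_us hh)
  rcases S.V (Subfield.closure (us H)) (fun m hm => conj_closure m (hn m hm)) with h | h | h
  · exact h
  · exfalso; apply hna
    intro x hx y hy
    exact Subgroup.mem_center_iff.mp (h y (S.le (hHM hy)) (hsub y hy)) x
  · exfalso; apply hna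
    intro x hx y hy
    exact ucomm ((h x (S.le (hHM hx)) (hsub x hx)).2 y (hsub y hy))

theorem Setup.genM (S : Setup G M N n s) : ∀ x, x ∈ Subfield.closure (us M) :=
  S.gen M le_rfl (self_conj M) S.nonab

end DM


namespace DM
open scoped commutatorElement
set_option linter.unusedVariables false

variable {D : Type*} [DivisionRing D]

/-- right multiplication as a linear map over a division subring -/
def rmul (L : Subfield D) (a : D) : D →ₗ[L] D where
  toFun := fun d => d * a
  map_add' := fun x y => add_mul x y a
  map_smul' := fun l x => mul_assoc (l : D) x a

theorem rmul_apply (L : Subfield D) (a d : D) : rmul L a d = d * a := rfl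

theorem rmul_inj (L : Subfield D) {a : D} (ha : a ≠ 0) : Function.Injective (rmul L a) :=
  fun _ _ h => mul_right_cancel₀ ha h

theorem smul_val (L : Subfield D) (l : L) (d : D) : l • d = (l : D) * d := rfl

theorem span_mul (L : Subfield D) (S S' : Set D) (V : Submodule L D)
    (hS : ∀ s ∈ S, ∃ h : Dˣ, (h : D) = s ∧ ∀ x ∈ L, (h : D) * x * (h⁻¹ : Dˣ) ∈ L)
    (hV : ∀ s ∈ S, ∀ s' ∈ S', s * s' ∈ V) {a b : D} (ha : a ∈ Submodule.span L S)
    (hb : b ∈ Submodule.span L S') : a * b ∈ V := by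
  induction ha using Submodule.span_induction with
  | zero => rw [zero_mul]; exact V.zero_mem
  | add x y _ _ hx hy => rw [add_mul]; exact V.add_mem hx hy
  | smul l x _ hx =>
    have : (l • x) * b = l • (x * b) := mul_assoc _ _ _
    rw [this]; exact V.smul_mem _ hx
  | mem s hs =>
    obtain ⟨h, rfl, hh⟩ := hS s hs
    induction hb using Submodule.span_induction with
    | zero => rw [mul_zero]; exact V.zero_mem
    | add x y _ _ hx hy => rw [mul_add]; exact V.add_mem hx hy
    | mem x hx => exact hV _ hs x hx
    | smul l x _ hx =>
      have : (h : D) * (l • x) = (⟨_, hh l l.2⟩ : L) • ((h : D) * x) := by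
        rw [smul_val, smul_val]
        simp [mul_assoc]
      rw [this]; exact V.smul_mem _ hx

theorem exp_beats (k : ℕ) : ∃ n : ℕ, (n + 1) ^ k < 2 ^ n := by
  have h := tendsto_pow_const_div_const_pow_of_one_lt k (r := (2 : ℝ)) (by norm_num)
  have h2 := h.eventually (gt_mem_nhds (show (0 : ℝ) < 1 / 2 by norm_num))
  obtain ⟨n, hn1, hn⟩ := ((Filter.eventually_ge_atTop 1).and h2).exists
  obtain ⟨m, rfl⟩ : ∃ m, n = m + 1 := ⟨n - 1, by omega⟩
  refine ⟨m, ?_⟩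
  rw [div_lt_iff₀ (by positivity), pow_succ] at hn
  have : ((m + 1 : ℕ) : ℝ) ^ k < 2 ^ m := by linarith
  exact_mod_cast this

/-- the growth argument -/
theorem ore (L : Subfield D) (H : Subgroup Dˣ)
    (hn : ∀ h ∈ H, ∀ x ∈ L, (h : D) * x * (h⁻¹ : Dˣ) ∈ L) (hc : ∀ h ∈ ⁅H, H⁆, (h : D) ∈ L)
    {a b : D} (ha : a ∈ Submodule.span L (us H)) (hb : b ∈ Submodule.span L (us H))
    (ha0 : a ≠ 0) (hb0 : b ≠ 0) :
    ∃ s ∈ Submodule.span L (us H), ∃ t ∈ Submodule.span L (us H), s * a = t * b ∧ s * a ≠ 0 := by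
  classical
  -- a finite set of generators
  obtain ⟨T, haT, hbT⟩ : ∃ T : Finset H, a ∈ Submodule.span L ((fun h : H => ((h : Dˣ) : D)) '' T) ∧
      b ∈ Submodule.span L ((fun h : H => ((h : Dˣ) : D)) '' T) := by
    have e : us H = (fun h : H => ((h : Dˣ) : D)) '' Set.univ := by
      ext x; constructor
      · rintro ⟨h, hh, rfl⟩; exact ⟨⟨h, hh⟩, trivial, rfl⟩
      · rintro ⟨h, -, rfl⟩; exact mem_us h.2
    rw [e] at ha hb
    rw [Submodule.mem_span_image_iff_exists_fun] at ha hb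
    obtain ⟨t1, -, c1, h1⟩ := ha
    obtain ⟨t2, -, c2, h2⟩ := hb
    refine ⟨t1 ∪ t2, ?_, ?_⟩
    · rw [← h1]
      refine Submodule.sum_mem _ fun i _ => Submodule.smul_mem _ _ (Submodule.subset_span ⟨i, ?_, rfl⟩)
      simp
    · rw [← h2]
      refine Submodule.sum_mem _ fun i _ => Submodule.smul_mem _ _ (Submodule.subset_span ⟨i, ?_, rfl⟩)
      simp
  let φ : H →* Abelianization H := Abelianization.of
  have hφ : ∀ h h' : H, φ h = φ h' → (((h : Dˣ) * (h' : Dˣ)⁻¹ : Dˣ) : D) ∈ L := by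
    intro h h' e
    apply hc
    have h1 : h * h'⁻¹ ∈ φ.ker := by rw [MonoidHom.mem_ker, map_mul, map_inv, e, mul_inv_cancel]
    rw [Abelianization.ker_of] at h1
    have h2 := Subgroup.mem_map_of_mem H.subtype h1
    rw [commutator_def, Subgroup.map_commutator] at h2
    rw [← MonoidHom.range_eq_map, Subgroup.range_subtype] at h2
    exact h2
  let E : ℕ → Finset (Abelianization H) := fun n =>
    Finset.univ.image (fun e : T → Fin (n + 1) => ∏ t : T, (φ t) ^ (e t : ℕ))
  have hEcard : ∀ n, (E n).card ≤ (n + 1) ^ T.card := by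
    intro n
    refine Finset.card_image_le.trans ?_
    simp
  have hE1 : ∀ n, 1 ∈ E n := fun n => Finset.mem_image.mpr ⟨fun _ => 0, Finset.mem_univ _, by simp⟩
  have hEs : ∀ n, ∀ x ∈ E n, ∀ t ∈ T, x * φ t ∈ E (n + 1) := by
    intro n x hx t ht
    obtain ⟨e, -, rfl⟩ := Finset.mem_image.mp hx
    refine Finset.mem_image.mpr ⟨fun u => ⟨(e u : ℕ) + if u = ⟨t, ht⟩ then 1 else 0, ?_⟩,
      Finset.mem_univ _, ?_⟩
    · have := (e u).2
      split_ifs <;> omega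
    · simp only [pow_add, Finset.prod_mul_distrib, Finset.prod_ite_eq', pow_ite, pow_one, pow_zero, Finset.mem_univ, if_true]
  let W : ℕ → Set D := fun n => {d | ∃ h : H, ((h : Dˣ) : D) = d ∧ φ h ∈ E n}
  let V : ℕ → Submodule L D := fun n => Submodule.span L (W n)
  have hWus : ∀ n, W n ⊆ us H := by
    rintro n _ ⟨h, rfl, -⟩; exact mem_us h.2
  have hVR : ∀ n, V n ≤ Submodule.span L (us H) := fun n => Submodule.span_mono (hWus n)
  choose r hr using (QuotientGroup.mk'_surjective (commutator H) : Function.Surjective φ)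
  have hVle : ∀ n, V n ≤ Submodule.span L (((E n).image (fun x => ((r x : Dˣ) : D)) : Finset D) : Set D) := by
    intro n
    apply Submodule.span_le.mpr
    rintro _ ⟨h, rfl, hh⟩
    have h1 := hφ h (r (φ h)) (hr (φ h)).symm
    have h2 : ((h : Dˣ) : D) = (⟨_, h1⟩ : L) • (((r (φ h) : H) : Dˣ) : D) := by
      rw [smul_val]; simp
    rw [h2]
    refine Submodule.smul_mem _ _ (Submodule.subset_span ?_)
    exact Finset.mem_coe.mpr (Finset.mem_image.mpr ⟨_, hh, rfl⟩)
  have hfin : ∀ n, Module.Finite L (V n) := by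
    intro n
    have := Module.Finite.span_of_finite L (A := (((E n).image (fun x => ((r x : Dˣ) : D)) : Finset D) : Set D))
      (Finset.finite_toSet _)
    exact Submodule.finiteDimensional_of_le (hVle n)
  have hup : ∀ n, Module.finrank L (V n) ≤ (n + 1) ^ T.card := by
    intro n
    have := Module.Finite.span_of_finite L (A := (((E n).image (fun x => ((r x : Dˣ) : D)) : Finset D) : Set D))
      (Finset.finite_toSet _)
    refine (Submodule.finrank_mono (hVle n)).trans ?_
    refine (finrank_span_finset_le_card _).trans (Finset.card_image_le.trans (hEcard n))
  by_contra hcon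
  have hstep : ∀ n c, c ∈ Submodule.span L ((fun h : H => ((h : Dˣ) : D)) '' T) →
      (V n).map (rmul L c) ≤ V (n + 1) := by
    rintro n c hcT _ ⟨v, hv, rfl⟩
    refine span_mul L (W n) _ _ ?_ ?_ hv hcT
    · rintro _ ⟨h, rfl, -⟩
      exact ⟨h, rfl, hn h h.2⟩
    · rintro _ ⟨h, rfl, hh⟩ _ ⟨t, ht, rfl⟩
      refine Submodule.subset_span ⟨h * t, by simp, ?_⟩
      rw [map_mul]; exact hEs n _ hh t ht
  have hlow : ∀ n, 2 ^ n ≤ Module.finrank L (V n) := by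
    intro n
    induction n with
    | zero =>
      rw [pow_zero, Nat.one_le_iff_ne_zero]
      intro h0
      have := (Submodule.finrank_eq_zero).mp h0
      have h1 : (1 : D) ∈ V 0 := Submodule.subset_span ⟨1, by simp, by rw [map_one]; exact hE1 0⟩
      rw [this] at h1
      exact one_ne_zero ((Submodule.mem_bot _).mp h1)
    | succ n ih =>
      have hd : Disjoint ((V n).map (rmul L a)) ((V n).map (rmul L b)) := by
        rw [Submodule.disjoint_def]
        rintro _ ⟨v, hv, rfl⟩ ⟨w, hw, hwv⟩
        by_contra hne
        exact hcon ⟨v, hVR n hv, w, hVR n hw, hwv.symm, hne⟩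
      have h1 := (Submodule.equivMapOfInjective _ (rmul_inj L ha0) (V n)).finrank_eq
      have h2 := (Submodule.equivMapOfInjective _ (rmul_inj L hb0) (V n)).finrank_eq
      have h3 := Submodule.finrank_sup_add_finrank_inf_eq ((V n).map (rmul L a)) ((V n).map (rmul L b))
      rw [hd.eq_bot, finrank_bot, add_zero] at h3
      have h4 := Submodule.finrank_mono (sup_le (hstep n a haT) (hstep n b hbT))
      rw [pow_succ]
      omega
  obtain ⟨n, hn'⟩ := exp_beats T.card
  exact absurd ((hlow n).trans (hup n)) (not_le.mpr hn')

theorem ore_all (L : Subfield D) (H : Subgroup Dˣ)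
    (hn : ∀ h ∈ H, ∀ x ∈ L, (h : D) * x * (h⁻¹ : Dˣ) ∈ L) (hc : ∀ h ∈ ⁅H, H⁆, (h : D) ∈ L)
    (hcl : ∀ x, x ∈ Subfield.closure (us H)) (d : D) :
    ∃ q ∈ Submodule.span L (us H), q ≠ 0 ∧ q * d ∈ Submodule.span L (us H) := by
  set R := Submodule.span L (us H) with hR
  have hmul : ∀ {a b}, a ∈ R → b ∈ R → a * b ∈ R := by
    intro a b ha hb
    refine span_mul L (us H) (us H) R ?_ ?_ ha hb
    · rintro _ ⟨h, hh, rfl⟩; exact ⟨h, rfl, hn h hh⟩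
    · rintro _ ⟨h, hh, rfl⟩ _ ⟨h', hh', rfl⟩
      exact Submodule.subset_span ⟨h * h', H.mul_mem hh hh', by simp⟩
  have h1 : (1 : D) ∈ R := Submodule.subset_span ⟨1, H.one_mem, by simp⟩
  let K : Subfield D := {
    carrier := {d | ∃ q ∈ R, q ≠ 0 ∧ q * d ∈ R}
    mul_mem' := by
      rintro d d' ⟨q, hq, hq0, hqd⟩ ⟨q', hq', hq0', hqd'⟩
      by_cases h0 : d = 0
      · exact ⟨1, h1, one_ne_zero, by simp [h0]⟩
      obtain ⟨s, hs, t, ht, hst, hne⟩ := ore L H hn hc hqd hq' (mul_ne_zero hq0 h0) hq0'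
      refine ⟨s * q, hmul hs hq, mul_ne_zero (left_ne_zero_of_mul hne) hq0, ?_⟩
      have : s * q * (d * d') = t * (q' * d') := by
        calc s * q * (d * d') = s * (q * d) * d' := by simp only [mul_assoc]
          _ = _ := by rw [hst, mul_assoc]
      rw [this]; exact hmul ht hqd'
    one_mem' := ⟨1, h1, one_ne_zero, by simpa using h1⟩
    add_mem' := by
      rintro d d' ⟨q, hq, hq0, hqd⟩ ⟨q', hq', hq0', hqd'⟩
      obtain ⟨s, hs, t, ht, hst, hne⟩ := ore L H hn hc hq hq' hq0 hq0'
      refine ⟨s * q, hmul hs hq, hne, ?_⟩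
      have : s * q * (d + d') = s * (q * d) + t * (q' * d') := by
        rw [mul_add, mul_assoc s q d, hst, mul_assoc]
      rw [this]; exact R.add_mem (hmul hs hqd) (hmul ht hqd')
    zero_mem' := ⟨1, h1, one_ne_zero, by simp⟩
    neg_mem' := by
      rintro d ⟨q, hq, hq0, hqd⟩
      exact ⟨q, hq, hq0, by rw [mul_neg]; exact R.neg_mem hqd⟩
    inv_mem' := by
      rintro d ⟨q, hq, hq0, hqd⟩
      by_cases h0 : d = 0
      · exact ⟨1, h1, one_ne_zero, by simp [h0]⟩
      exact ⟨q * d, hqd, mul_ne_zero hq0 h0, by rw [mul_assoc, mul_inv_cancel₀ h0, mul_one]; exact hq⟩ }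
  have hle : Subfield.closure (us H) ≤ K := by
    apply Subfield.closure_le.mpr
    intro x hx
    exact ⟨1, h1, one_ne_zero, by rw [one_mul]; exact Submodule.subset_span hx⟩
  exact hle (hcl d)

end DM


namespace DM
open scoped commutatorElement
set_option linter.unusedVariables false

variable {D : Type*} [DivisionRing D]

/-- weight space -/
def wsp {L : Subfield D} (hL : ∀ x ∈ L, ∀ y ∈ L, x * y = y * x) {Ω : Type*} (T : Ω → (D →ₗ[L] D))
    (w : Ω → L) : Submodule L D where
  carrier := {v | ∀ ω, T ω v = w ω • v}
  add_mem' := by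
    intro a b ha hb ω
    rw [map_add, ha, hb, smul_add]
  zero_mem' := by intro ω; simp
  smul_mem' := by
    intro c v hv ω
    rw [map_smul, hv, smul_smul, smul_smul]
    congr 1
    exact Subtype.ext (hL _ c.2 _ (w ω).2)

theorem wsp_indep {L : Subfield D} (hL : ∀ x ∈ L, ∀ y ∈ L, x * y = y * x) {Ω : Type*}
    (T : Ω → (D →ₗ[L] D)) (I : Finset (Ω → L)) : ∀ v : (Ω → L) → D, (∀ w ∈ I, v w ∈ wsp hL T w) →
    ∑ w ∈ I, v w = 0 → ∀ w ∈ I, v w = 0 := by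
  classical
  induction I using Finset.induction_on with
  | empty => intro v _ _ w hw; simp at hw
  | insert w0 I hw0 ih =>
    intro v hv hs
    have hI : ∀ w ∈ I, v w = 0 := by
      intro w hw
      have hne : w ≠ w0 := fun h => hw0 (h ▸ hw)
      obtain ⟨ω, hω⟩ := Function.ne_iff.mp hne
      have h1 := ih (fun w => (w ω - w0 ω) • v w)
        (fun w hw => Submodule.smul_mem _ _ (hv w (Finset.mem_insert_of_mem hw))) (by
          have h2 : T ω (∑ w ∈ insert w0 I, v w) - w0 ω • (∑ w ∈ insert w0 I, v w) = 0 := by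
            rw [hs]; simp
          rw [map_sum, Finset.smul_sum, ← Finset.sum_sub_distrib, Finset.sum_insert hw0,
            hv w0 (Finset.mem_insert_self _ _) ω, sub_self, zero_add] at h2
          rw [← h2]
          refine Finset.sum_congr rfl fun w hw => ?_
          rw [hv w (Finset.mem_insert_of_mem hw) ω, sub_smul]) w hw
      exact (smul_eq_zero.mp h1).resolve_left (sub_ne_zero.mpr hω)
    intro w hw
    rcases Finset.mem_insert.mp hw with rfl | hw
    · rw [Finset.sum_insert hw0, Finset.sum_eq_zero hI, add_zero] at hs
      exact hs
    · exact hI w hw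

theorem wsp_disj {L : Subfield D} (hL : ∀ x ∈ L, ∀ y ∈ L, x * y = y * x) {Ω : Type*}
    (T : Ω → (D →ₗ[L] D)) (S S' : Set D) (wt : D → Ω → L) (hS : ∀ v ∈ S, v ∈ wsp hL T (wt v))
    (hS' : ∀ v ∈ S', v ∈ wsp hL T (wt v)) (hne : ∀ v ∈ S, ∀ v' ∈ S', wt v ≠ wt v') :
    Disjoint (Submodule.span L S) (Submodule.span L S') := by
  classical
  let p : Set D → (Ω → L) → Submodule L D := fun S w => if w ∈ wt '' S then wsp hL T w else ⊥
  have hp : ∀ S : Set D, (∀ v ∈ S, v ∈ wsp hL T (wt v)) → Submodule.span L S ≤ iSup (p S) := by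
    intro S hS
    apply Submodule.span_le.mpr
    intro v hv
    have : p S (wt v) = wsp hL T (wt v) := if_pos ⟨v, hv, rfl⟩
    exact (le_iSup (p S) (wt v)) (by rw [this]; exact hS v hv)
  have hple : ∀ S w, p S w ≤ wsp hL T w := by
    intro S w
    by_cases h : w ∈ wt '' S
    · simp only [p, if_pos h]; exact le_rfl
    · simp only [p, if_neg h]; exact bot_le
  rw [Submodule.disjoint_def]
  intro x hx hx'
  obtain ⟨f, hf, rfl⟩ := (Submodule.mem_iSup_iff_exists_finsupp _ _).mp (hp S hS hx)
  obtain ⟨g, hg, hfg⟩ := (Submodule.mem_iSup_iff_exists_finsupp _ _).mp (hp S' hS' hx')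
  have h0 : (f - g).sum (fun _ x => x) = 0 := by
    rw [Finsupp.sum_sub_index (by simp), hfg, sub_self]
  have h1 := wsp_indep hL T (f - g).support (f - g)
    (fun w _ => Submodule.sub_mem _ (hple S w (hf w)) (hple S' w (hg w))) h0
  have hf0 : ∀ w, f w = 0 := by
    intro w
    by_cases hw : w ∈ wt '' S
    · have hw' : w ∉ wt '' S' := by
        rintro ⟨v', hv', h'⟩
        obtain ⟨v, hv, h⟩ := hw
        exact hne v hv v' hv' (h.trans h'.symm)
      have hg0 : g w = 0 := by
        have := hg w
        simp only [p, hw', if_false] at this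
        exact (Submodule.mem_bot _).mp this
      by_cases hs : w ∈ (f - g).support
      · have := h1 w hs
        simpa [hg0] using this
      · simpa [hg0] using hs
    · have := hf w
      simp only [p, hw, if_false] at this
      exact (Submodule.mem_bot _).mp this
  have : f = 0 := Finsupp.ext hf0
  simp [this]

/-- crossed product independence -/
def CP (L : Subfield D) (Γ : Subgroup Dˣ) : Prop :=
  ∀ S S' : Set Dˣ, S ⊆ Γ → S' ⊆ Γ → (∀ s ∈ S, ∀ s' ∈ S', ((s * s'⁻¹ : Dˣ) : D) ∉ L) →
    Disjoint (Submodule.span L (Units.val '' S)) (Submodule.span L (Units.val '' S'))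

theorem CP_case1 {L : Subfield D} (hL : ∀ x ∈ L, ∀ y ∈ L, x * y = y * x) (Γ : Subgroup Dˣ)
    (hn : ∀ h ∈ Γ, ∀ x ∈ L, (h : D) * x * (h⁻¹ : Dˣ) ∈ L)
    (hC : ∀ g ∈ Γ, (∀ x ∈ L, g * x = x * g) → (g : D) ∈ L) : CP L Γ := by
  classical
  intro S S' hS hS' hne
  let wt : D → L → L := fun d x => if h : d * x * d⁻¹ ∈ L then ⟨_, h⟩ else 0
  have hwt : ∀ g ∈ Γ, ∀ x : L, (wt g x : D) = g * x * (g⁻¹ : Dˣ) := by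
    intro g hg x
    have := hn g hg x x.2
    rw [Units.val_inv_eq_inv_val] at this ⊢
    simp only [wt, this, dif_pos]
  have hw : ∀ g ∈ Γ, (g : D) ∈ wsp hL (fun x : L => rmul L (x : D)) (wt g) := by
    intro g hg x
    rw [rmul_apply, smul_val, hwt g hg]
    simp
  refine wsp_disj hL (fun x : L => rmul L (x : D)) _ _ wt ?_ ?_ ?_
  · rintro _ ⟨g, hg, rfl⟩; exact hw g (hS hg)
  · rintro _ ⟨g, hg, rfl⟩; exact hw g (hS' hg)
  · rintro _ ⟨g, hg, rfl⟩ _ ⟨g', hg', rfl⟩ e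
    apply hne g hg g' hg'
    have h1 : ((g'⁻¹ * g : Dˣ) : D) ∈ L := by
      apply hC _ (Γ.mul_mem (Γ.inv_mem (hS' hg')) (hS hg))
      intro x hx
      have h2 : (wt g ⟨x, hx⟩ : D) = wt g' ⟨x, hx⟩ := by rw [e]
      rw [hwt g (hS hg), hwt g' (hS' hg')] at h2
      have h3 : (g'⁻¹ : Dˣ) * ((g : D) * x * (g⁻¹ : Dˣ)) * g = (g'⁻¹ : Dˣ) * ((g' : D) * x * (g'⁻¹ : Dˣ)) * g := by
        rw [h2]
      simpa [mul_assoc] using h3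
    have h2 := hn g' (hS' hg') _ h1
    simpa [mul_assoc] using h2

theorem CP_case2 {L : Subfield D} (hL : ∀ x, x ∈ L ↔ ∀ y, y * x = x * y) (Γ : Subgroup Dˣ)
    (hn : ∀ g ∈ Γ, ∀ h ∈ Γ, (((g * h * g⁻¹ * h⁻¹ : Dˣ)) : D) ∈ L)
    (hC : ∀ g : Dˣ, (∀ h ∈ Γ, g * h = h * g) → (g : D) ∈ L) : CP L Γ := by
  classical
  intro S S' hS hS' hne
  have hLc : ∀ x ∈ L, ∀ y ∈ L, x * y = y * x := fun x hx y hy => (hL y).mp hy x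
  let cT : Γ → (D →ₗ[L] D) := fun g =>
    { toFun := fun d => (g : Dˣ) * d * ((g : Dˣ)⁻¹ : Dˣ)
      map_add' := fun x y => by simp [mul_add, add_mul]
      map_smul' := fun l x => by
        simp only [smul_val, RingHom.id_apply, ← mul_assoc]
        rw [(hL l).mp l.2] }
  let wt : D → Γ → L := fun d x => if h : ((x : Dˣ) : D) * d * ((x : Dˣ)⁻¹ : Dˣ) * d⁻¹ ∈ L then ⟨_, h⟩ else 0
  have hwt : ∀ g ∈ Γ, ∀ x : Γ, (wt g x : D) = (((x : Dˣ) * g * (x : Dˣ)⁻¹ * g⁻¹ : Dˣ) : D) := by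
    intro g hg x
    have h1 := hn x x.2 g hg
    have h2 : (((x : Dˣ) * g * (x : Dˣ)⁻¹ * g⁻¹ : Dˣ) : D) = (x : Dˣ) * g * ((x : Dˣ)⁻¹ : Dˣ) * (g : D)⁻¹ := by simp
    rw [h2] at h1 ⊢
    simp only [wt, h1, dif_pos]
  have hw : ∀ g ∈ Γ, (g : D) ∈ wsp hLc cT (wt g) := by
    intro g hg x
    have := hwt g hg x
    rw [smul_val, this]
    simp [cT]
  refine wsp_disj hLc cT _ _ wt ?_ ?_ ?_
  · rintro _ ⟨g, hg, rfl⟩; exact hw g (hS hg)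
  · rintro _ ⟨g, hg, rfl⟩; exact hw g (hS' hg)
  · rintro _ ⟨g, hg, rfl⟩ _ ⟨g', hg', rfl⟩ e
    apply hne g hg g' hg'
    apply hC
    intro h hh
    have h2 : (wt g ⟨h, hh⟩ : D) = wt g' ⟨h, hh⟩ := by rw [e]
    rw [hwt g (hS hg), hwt g' (hS' hg'), Units.val_inj] at h2
    simp only at h2
    -- h g h⁻¹ g⁻¹ = h g' h⁻¹ g'⁻¹, both central
    have hz : h * g' * h⁻¹ * g'⁻¹ ∈ Subgroup.center Dˣ := by
      rw [Subgroup.mem_center_iff]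
      intro y
      ext
      exact (hL _).mp (hn h hh g' (hS' hg')) y
    have h3 : h * g * h⁻¹ = (h * g' * h⁻¹ * g'⁻¹) * g := by rw [← h2]; group
    have h4 : h * g' * h⁻¹ = (h * g' * h⁻¹ * g'⁻¹) * g' := by group
    set z := h * g' * h⁻¹ * g'⁻¹ with hzdef
    have h5 : h * (g * g'⁻¹) * h⁻¹ = g * g'⁻¹ := by
      calc h * (g * g'⁻¹) * h⁻¹ = (h * g * h⁻¹) * (h * g' * h⁻¹)⁻¹ := by group
        _ = z * g * (z * g')⁻¹ := by rw [h3, h4]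
        _ = z * (g * g'⁻¹) * z⁻¹ := by group
        _ = (g * g'⁻¹) * z * z⁻¹ := by rw [Subgroup.mem_center_iff.mp hz]
        _ = _ := by group
    calc g * g'⁻¹ * h = (h * (g * g'⁻¹) * h⁻¹) * h := by rw [h5]
      _ = _ := by group

theorem lemX {L : Subfield D} {Γ H : Subgroup Dˣ} (hcp : CP L Γ) (hHΓ : H ≤ Γ)
    (hle : ∀ g ∈ Γ, (g : D) ∈ L → g ∈ H) (hn : ∀ h ∈ H, ∀ x ∈ L, (h : D) * x * (h⁻¹ : Dˣ) ∈ L)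
    (hc : ∀ h ∈ ⁅H, H⁆, (h : D) ∈ L) (hcl : ∀ x, x ∈ Subfield.closure (us H)) : Γ ≤ H := by
  intro m hm
  by_contra hmH
  obtain ⟨q, hq, hq0, hqm⟩ := ore_all L H hn hc hcl m
  have hd := hcp (H : Set Dˣ) {x | ∃ h ∈ H, x = h * m} hHΓ
    (by rintro _ ⟨h, hh, rfl⟩; exact Γ.mul_mem (hHΓ hh) hm) (by
      rintro s hs _ ⟨h, hh, rfl⟩ hL
      have h1 := hle _ (Γ.mul_mem (hHΓ hs) (Γ.inv_mem (Γ.mul_mem (hHΓ hh) hm))) hL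
      apply hmH
      have : m = h⁻¹ * (s * (h * m)⁻¹)⁻¹ * s := by group
      rw [this]
      exact H.mul_mem (H.mul_mem (H.inv_mem hh) (H.inv_mem h1)) hs)
  have h1 : q * m ∈ Submodule.span L (Units.val '' {x : Dˣ | ∃ h ∈ H, x = h * m}) := by
    have : (Submodule.span L (us H)).map (rmul L (m : D)) ≤
        Submodule.span L (Units.val '' {x : Dˣ | ∃ h ∈ H, x = h * m}) := by
      rw [Submodule.map_span]
      apply Submodule.span_mono
      rintro _ ⟨_, ⟨h, hh, rfl⟩, rfl⟩
      exact ⟨h * m, ⟨h, hh, rfl⟩, by simp [rmul_apply]⟩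
    exact this ⟨q, hq, rfl⟩
  have := Submodule.disjoint_def.mp hd _ hqm h1
  exact mul_ne_zero hq0 m.ne_zero this

end DM


namespace DM
open scoped commutatorElement
set_option linter.unusedVariables false

variable {D : Type*} [DivisionRing D]

theorem fd_lemma (L : Subfield D) (Γ : Subgroup Dˣ)
    (hn : ∀ h ∈ Γ, ∀ x ∈ L, (h : D) * x * (h⁻¹ : Dˣ) ∈ L)
    (hi : (unitsIn L Γ).relIndex Γ ≠ 0) (hcl : ∀ x, x ∈ Subfield.closure (us Γ)) :
    Module.Finite L D := by
  have hfin : Finite (Γ ⧸ (unitsIn L Γ).subgroupOf Γ) := Subgroup.index_ne_zero_iff_finite.mp hi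
  set R := Submodule.span L (us Γ) with hR
  have hmul : ∀ {a b}, a ∈ R → b ∈ R → a * b ∈ R := by
    intro a b ha hb
    refine span_mul L (us Γ) (us Γ) R ?_ ?_ ha hb
    · rintro _ ⟨h, hh, rfl⟩; exact ⟨h, rfl, hn h hh⟩
    · rintro _ ⟨h, hh, rfl⟩ _ ⟨h', hh', rfl⟩
      exact Submodule.subset_span ⟨h * h', Γ.mul_mem hh hh', by simp⟩
  have h1 : (1 : D) ∈ R := Submodule.subset_span ⟨1, Γ.one_mem, by simp⟩
  let X : Set D := Set.range (fun q : Γ ⧸ (unitsIn L Γ).subgroupOf Γ => (((q.out : Γ) : Dˣ)⁻¹ : Dˣ) : _ → D)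
  have hX : X.Finite := Set.finite_range _
  have hRX : R ≤ Submodule.span L X := by
    apply Submodule.span_le.mpr
    rintro _ ⟨g, hg, rfl⟩
    let g' : Γ := ⟨g, hg⟩
    let q : Γ ⧸ (unitsIn L Γ).subgroupOf Γ := QuotientGroup.mk g'⁻¹
    have h2 : (QuotientGroup.mk q.out : Γ ⧸ (unitsIn L Γ).subgroupOf Γ) = QuotientGroup.mk g'⁻¹ :=
      Quotient.out_eq' q
    have h3 := QuotientGroup.eq.mp h2
    have h4 : (((q.out : Γ) : Dˣ)⁻¹ * g⁻¹) ∈ unitsIn L Γ := Subgroup.mem_subgroupOf.mp h3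
    have h5 := ((unitsIn L Γ).inv_mem h4).2
    have h6 : (g : D) = (⟨_, h5⟩ : L) • ((((q.out : Γ) : Dˣ)⁻¹ : Dˣ) : D) := by
      rw [smul_val]; simp
    rw [h6]
    exact Submodule.smul_mem _ _ (Submodule.subset_span ⟨q, rfl⟩)
  have hf1 := Module.Finite.span_of_finite L hX
  have hf2 : FiniteDimensional L R := Submodule.finiteDimensional_of_le hRX
  let K : Subfield D := {
    carrier := R
    mul_mem' := hmul
    one_mem' := h1
    add_mem' := R.add_mem
    zero_mem' := R.zero_mem
    neg_mem' := fun h => R.neg_mem h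
    inv_mem' := by
      intro a ha
      by_cases h0 : a = 0
      · rw [h0, inv_zero]; exact R.zero_mem
      have hmaps : ∀ x ∈ R, rmul L a x ∈ R := fun x hx => hmul hx ha
      have hinj : Function.Injective ((rmul L a).restrict hmaps) := by
        intro x y hxy
        exact Subtype.ext (rmul_inj L h0 (congrArg Subtype.val hxy))
      obtain ⟨s, hs⟩ := LinearMap.surjective_of_injective hinj ⟨1, h1⟩
      have hs' : (s : D) * a = 1 := congrArg Subtype.val hs
      rw [← eq_inv_of_mul_eq_one_left hs']
      exact s.2 }
  have hle : Subfield.closure (us Γ) ≤ K := by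
    apply Subfield.closure_le.mpr
    intro x hx
    exact Submodule.subset_span hx
  have htop : R = ⊤ := by
    rw [eq_top_iff]
    exact fun x _ => hle (hcl x)
  rw [htop] at hf2
  exact Module.finite_def.mpr ((Submodule.fg_top _).mp (Module.finite_def.mp hf2) |> fun h => h)

end DM


namespace DM
open scoped commutatorElement
set_option linter.unusedVariables false

section grp
variable {Γ : Type*} [Group Γ]

/-- the product `A * P` when `P` normalises `A` -/
def prodSub (A P : Subgroup Γ) (h : ∀ p ∈ P, ∀ a ∈ A, p * a * p⁻¹ ∈ A) : Subgroup Γ where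
  carrier := {x | ∃ p ∈ P, x * p⁻¹ ∈ A}
  mul_mem' := by
    rintro x y ⟨p, hp, hx⟩ ⟨q, hq, hy⟩
    refine ⟨p * q, P.mul_mem hp hq, ?_⟩
    have : x * y * (p * q)⁻¹ = (x * p⁻¹) * (p * (y * q⁻¹) * p⁻¹) := by group
    rw [this]; exact A.mul_mem hx (h p hp _ hy)
  one_mem' := ⟨1, P.one_mem, by simp [A.one_mem]⟩
  inv_mem' := by
    rintro x ⟨p, hp, hx⟩
    refine ⟨p⁻¹, P.inv_mem hp, ?_⟩
    have : x⁻¹ * p⁻¹⁻¹ = p⁻¹ * (x * p⁻¹)⁻¹ * p⁻¹⁻¹ := by group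
    rw [this]; exact h _ (P.inv_mem hp) _ (A.inv_mem hx)

variable {A P : Subgroup Γ} {h : ∀ p ∈ P, ∀ a ∈ A, p * a * p⁻¹ ∈ A}

theorem mem_prodSub {x : Γ} : x ∈ prodSub A P h ↔ ∃ p ∈ P, x * p⁻¹ ∈ A := Iff.rfl

theorem le_prodSub_left : A ≤ prodSub A P h := fun a ha => ⟨1, P.one_mem, by simpa using ha⟩

theorem le_prodSub_right : P ≤ prodSub A P h := fun p hp => ⟨p, hp, by simp [A.one_mem]⟩

theorem prodSub_le {M : Subgroup Γ} (hA : A ≤ M) (hP : P ≤ M) : prodSub A P h ≤ M := by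
  rintro x ⟨p, hp, hx⟩
  simpa using M.mul_mem (hA hx) (hP hp)

theorem prodSub_comm (hPP : ∀ p ∈ P, ∀ q ∈ P, p * q * p⁻¹ * q⁻¹ ∈ A) :
    ⁅prodSub A P h, prodSub A P h⁆ ≤ A := by
  apply Subgroup.commutator_le.mpr
  rintro x ⟨p, hp, hx⟩ y ⟨q, hq, hy⟩
  set a := x * p⁻¹ with ha
  set b := y * q⁻¹ with hb
  have e : ⁅x, y⁆ = a * (p * b * p⁻¹) * ((p * q * p⁻¹) * a⁻¹ * (p * q * p⁻¹)⁻¹) * (p * q * p⁻¹ * q⁻¹) * b⁻¹ := by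
    rw [commutatorElement_def, ha, hb]; group
  rw [e]
  exact A.mul_mem (A.mul_mem (A.mul_mem (A.mul_mem hx (h p hp b hy))
    (h _ (P.mul_mem (P.mul_mem hp hq) (P.inv_mem hp)) _ (A.inv_mem hx))) (hPP p hp q hq)) (A.inv_mem hy)

theorem prodSub_normal {M : Subgroup Γ} (hAM : ∀ m ∈ M, ∀ a ∈ A, m * a * m⁻¹ ∈ A)
    (hPM : ∀ m ∈ M, ∀ p ∈ P, m * p * m⁻¹ ∈ P) :
    ∀ m ∈ M, ∀ x ∈ prodSub A P h, m * x * m⁻¹ ∈ prodSub A P h := by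
  rintro m hm x ⟨p, hp, hx⟩
  refine ⟨m * p * m⁻¹, hPM m hm p hp, ?_⟩
  have : m * x * m⁻¹ * (m * p * m⁻¹)⁻¹ = m * (x * p⁻¹) * m⁻¹ := by group
  rw [this]; exact hAM m hm _ hx

theorem fin_of_cyclic {M : Subgroup Γ} (hAM : ∀ m ∈ M, ∀ a ∈ A, m * a * m⁻¹ ∈ A) {m : Γ} (hm : m ∈ M)
    (hgen : ∀ x ∈ M, ∃ k : ℤ, x * (m ^ k)⁻¹ ∈ A) {r : ℤ} (hr : r ≠ 0) (hmr : m ^ r ∈ A) :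
    A.relIndex M ≠ 0 := by
  apply Subgroup.index_ne_zero_iff_finite.mpr
  have hf : Set.Finite (Set.Ico 0 |r|) := Set.finite_Ico _ _
  have : Finite (Set.Ico 0 |r|) := hf
  refine Finite.of_surjective (fun i : Set.Ico 0 |r| =>
    (QuotientGroup.mk (⟨m, hm⟩ ^ (i : ℤ)) : M ⧸ A.subgroupOf M)) ?_
  intro q
  obtain ⟨x, rfl⟩ := QuotientGroup.mk_surjective q
  obtain ⟨k, hk⟩ := hgen x x.2
  refine ⟨⟨k % r, Int.emod_nonneg _ hr, Int.emod_lt_abs _ hr⟩, ?_⟩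
  apply QuotientGroup.eq.mpr
  rw [Subgroup.mem_subgroupOf]
  simp only [Subgroup.coe_mul, Subgroup.coe_inv, Subgroup.coe_zpow]
  have e : (m ^ (k % r))⁻¹ * (x : Γ) = (m ^ (-(k % r)) * ((x : Γ) * (m ^ k)⁻¹) * (m ^ (-(k % r)))⁻¹) * (m ^ r) ^ (k / r) := by
    have : m ^ k = m ^ (k % r) * (m ^ r) ^ (k / r) := by
      rw [← zpow_mul, ← zpow_add, Int.emod_add_mul_ediv]
    rw [this]
    set u := (m ^ r) ^ (k / r) with hu
    have hcom : u * m ^ (k % r) = m ^ (k % r) * u := by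
      rw [hu, ← zpow_mul, ← zpow_add, ← zpow_add, add_comm]
    rw [zpow_neg]
    have h2 : (m ^ (k % r) * u)⁻¹ = u⁻¹ * (m ^ (k % r))⁻¹ := by group
    rw [h2, inv_inv]
    have h3 : ∀ v w X : Γ, w * v = v * w → v⁻¹ * X = v⁻¹ * (X * (w⁻¹ * v⁻¹)) * v * w := by
      intro v w X hvw
      calc v⁻¹ * X = v⁻¹ * (X * (w⁻¹ * v⁻¹)) * (v * w) := by group
        _ = _ := by group
    exact h3 _ _ _ hcom
  rw [e]
  exact A.mul_mem (hAM _ (M.zpow_mem hm _) _ hk) (A.zpow_mem hmr _)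

end grp

variable {D : Type*} [DivisionRing D] {G M N : Subgroup Dˣ} {n s : ℕ}

theorem Setup.case1 (S : Setup G M N n s) (A : Subgroup Dˣ) (hAM : A ≤ M)
    (hAn : ∀ m ∈ M, ∀ a ∈ A, m * a * m⁻¹ ∈ A) (hAab : ∀ x ∈ A, ∀ y ∈ A, x * y = y * x)
    (hAnc : ¬ A ≤ Subgroup.center Dˣ) :
    ∃ L : Subfield D, (∀ x ∈ L, ∀ y ∈ L, x * y = y * x) ∧ Module.Finite L D := by
  let C := cent (us A)
  have hAC : ∀ a ∈ A, (a : D) ∈ C := by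
    rintro a ha _ ⟨b, hb, rfl⟩
    exact val_comm (hAab b hb a ha)
  have hMC : ∀ m ∈ M, ∀ x ∈ C, (m : D) * x * (m⁻¹ : Dˣ) ∈ C := by
    rintro m hm x hx _ ⟨b, hb, rfl⟩
    have h1 := hx _ (mem_us (hAn m⁻¹ (M.inv_mem hm) b hb))
    have h2 : (m : D) * (((m⁻¹ * b * m⁻¹⁻¹ : Dˣ) : D) * x) * (m⁻¹ : Dˣ) =
        (m : D) * (x * ((m⁻¹ * b * m⁻¹⁻¹ : Dˣ) : D)) * (m⁻¹ : Dˣ) := by rw [h1]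
    simpa [mul_assoc] using h2
  have hV : ∀ g ∈ G, (g : D) ∈ C → g ∈ M ∧ ∀ x ∈ C, g * x = x * g := by
    rcases S.V C hMC with h | h | h
    · exfalso; apply hAnc
      intro a ha
      rw [Subgroup.mem_center_iff]
      intro y
      exact ucomm (h y a (mem_us ha)).symm
    · exfalso; apply hAnc
      intro a ha
      exact h a (S.le (hAM ha)) (hAC a ha)
    · exact h
  let A₂ := unitsIn C G
  have hAA : A ≤ A₂ := fun a ha => ⟨S.le (hAM ha), hAC a ha⟩
  have hA₂M : A₂ ≤ M := fun g hg => (hV g hg.1 hg.2).1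
  have hA₂ab : ∀ x ∈ A₂, ∀ y ∈ A₂, x * y = y * x := fun x hx y hy => ucomm ((hV x hx.1 hx.2).2 y hy.2)
  have hA₂n : ∀ m ∈ M, ∀ a ∈ A₂, m * a * m⁻¹ ∈ A₂ := by
    intro m hm a ha
    refine ⟨G.mul_mem (G.mul_mem (S.le hm) ha.1) (G.inv_mem (S.le hm)), ?_⟩
    have := hMC m hm a ha.2
    simpa using this
  have hA₂c : ∀ m ∈ G, (∀ a ∈ A₂, m * a = a * m) → m ∈ A₂ := by
    intro m hm h
    refine ⟨hm, ?_⟩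
    rintro _ ⟨b, hb, rfl⟩
    exact (val_comm (h b (hAA hb))).symm
  let L := Subfield.closure (us A₂)
  have hL : ∀ x ∈ L, ∀ y ∈ L, x * y = y * x := us_comm hA₂ab
  have hA₂L : ∀ a ∈ A₂, (a : D) ∈ L := fun a ha => Subfield.subset_closure (mem_us ha)
  have hLA₂ : ∀ g ∈ G, (g : D) ∈ L → g ∈ A₂ := by
    intro g hg hgL
    exact hA₂c g hg fun a ha => ucomm (hL g hgL a (hA₂L a ha))
  have hML : ∀ m ∈ M, ∀ x ∈ L, (m : D) * x * (m⁻¹ : Dˣ) ∈ L := fun m hm => conj_closure m (hA₂n m hm)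
  have hcp : CP L M := CP_case1 hL M hML (by
    intro g hg hgx
    exact hA₂L g (hA₂c g (S.le hg) fun a ha => ucomm (hgx a (hA₂L a ha))))
  have hX : ∀ H : Subgroup Dˣ, H ≤ M → A₂ ≤ H → (∀ m ∈ M, ∀ h ∈ H, m * h * m⁻¹ ∈ H) → ¬ H ≤ A₂ →
      ⁅H, H⁆ ≤ A₂ → M ≤ H := by
    intro H hHM hAH hHn hne hHc
    refine lemX hcp hHM (fun g hg hgL => hAH (hLA₂ g (S.le hg) hgL)) (fun h hh => hML h (hHM hh))
      (fun h hh => hA₂L h (hHc hh)) (S.gen H hHM hHn ?_)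
    intro hab
    apply hne
    intro h hh
    exact hA₂c h (S.le (hHM hh)) fun a ha => hab h hh a (hAH ha)
  have hind : A₂.relIndex M ≠ 0 := by
    classical
    have hex : ∃ j, iterD N j ≤ A₂ := ⟨s, by rw [S.sol]; exact bot_le⟩
    obtain ⟨j, hj, hmin⟩ : ∃ j, iterD N j ≤ A₂ ∧ ∀ i < j, ¬ iterD N i ≤ A₂ :=
      ⟨Nat.find hex, Nat.find_spec hex, fun i hi => Nat.find_min hex hi⟩
    cases j with
    | zero =>
      intro h0
      exact S.ind (Subgroup.relIndex_eq_zero_of_le_left hj h0)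
    | succ j =>
      have hPM : iterD N j ≤ M := (iterD_le N j).trans S.NM
      have hPn : ∀ m ∈ M, ∀ p ∈ iterD N j, m * p * m⁻¹ ∈ iterD N j := fun m hm p hp =>
        conj_iterD_mem S.Nn j m hm p hp
      have hM1 := hX (prodSub A₂ (iterD N j) (fun p hp => hA₂n p (hPM hp))) (prodSub_le hA₂M hPM)
        le_prodSub_left (prodSub_normal hA₂n hPn)
        (fun h => hmin j (Nat.lt_succ_self j) (le_prodSub_right.trans h))
        (prodSub_comm (fun p hp q hq => hj (Subgroup.commutator_mem_commutator hp hq)))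
      have hMM : ∀ x ∈ M, ∀ y ∈ M, x * y * x⁻¹ * y⁻¹ ∈ A₂ := by
        intro x hx y hy
        exact prodSub_comm (fun p hp q hq => hj (Subgroup.commutator_mem_commutator hp hq))
          (Subgroup.commutator_mem_commutator (hM1 hx) (hM1 hy))
      have hcyc : ∀ m ∈ M, m ∉ A₂ → ∀ x ∈ M, ∃ k : ℤ, x * (m ^ k)⁻¹ ∈ A₂ := by
        intro m hm hmA x hx
        have hzM : Subgroup.zpowers m ≤ M := by rw [Subgroup.zpowers_le]; exact hm
        have hm1 := hX (prodSub A₂ (Subgroup.zpowers m) (fun p hp => hA₂n p (hzM hp)))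
          (prodSub_le hA₂M hzM) le_prodSub_left ?_
          (fun h => hmA (h (le_prodSub_right (Subgroup.mem_zpowers m))))
          (prodSub_comm (fun p hp q hq => hMM p (hzM hp) q (hzM hq)))
        · obtain ⟨p, ⟨k, rfl⟩, hp⟩ := hm1 hx
          exact ⟨k, hp⟩
        · intro y hy h hh
          have : y * h * y⁻¹ = (y * h * y⁻¹ * h⁻¹) * h := by group
          rw [this]
          exact Subgroup.mul_mem _ (le_prodSub_left (hMM y hy h (prodSub_le hA₂M hzM hh))) hh
      obtain ⟨m, hm, hmA⟩ : ∃ m ∈ M, m ∉ A₂ := by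
        by_contra hcon
        push Not at hcon
        exact S.nonab fun x hx y hy => hA₂ab x (hcon x hx) y (hcon y hy)
      by_cases hm2 : m ^ 2 ∈ A₂
      · exact fin_of_cyclic hA₂n hm (hcyc m hm hmA) (r := 2) (by norm_num) (by exact_mod_cast hm2)
      · obtain ⟨k, hk⟩ := hcyc (m ^ 2) (M.pow_mem hm 2) hm2 m hm
        refine fin_of_cyclic hA₂n hm (hcyc m hm hmA) (r := 1 - 2 * k) (by omega) ?_
        have : m ^ (1 - 2 * k) = m * ((m ^ 2) ^ k)⁻¹ := by
          rw [zpow_sub, zpow_one, zpow_mul]; rfl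
        rw [this]; exact hk
  refine ⟨L, hL, fd_lemma L M hML ?_ S.genM⟩
  intro h0
  exact hind (Subgroup.relIndex_eq_zero_of_le_left (fun g hg => ⟨hg.1, hg.2⟩ |> fun h : g ∈ A₂ => (⟨hA₂M h, hA₂L g h⟩ : g ∈ unitsIn L M)) h0)

end DM


namespace DM
open scoped commutatorElement
set_option linter.unusedVariables false

theorem fin_comm {T : Type*} [CommGroup T] [hfg : Group.FG T]
    (h : (∀ t : T, t ^ 2 = 1) ∨ (∀ t : T, ∃ u, t = u ^ 2)) : Finite T := by
  have htor : ∃ r : ℤ, r ≠ 0 ∧ ∀ t : T, t ^ r = 1 := by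
    rcases h with h | h
    · exact ⟨2, by norm_num, fun t => by exact_mod_cast h t⟩
    · have hf : Module.Finite ℤ (Additive T) :=
        Module.Finite.iff_addGroup_fg.mpr (GroupFG.iff_add_fg.mp hfg)
      obtain ⟨r, hr, hr'⟩ := Submodule.exists_sub_one_mem_and_smul_eq_zero_of_fg_of_le_smul
        (Ideal.span {(2 : ℤ)}) (⊤ : Submodule ℤ (Additive T)) (Module.finite_def.mp hf) (by
          intro t _
          obtain ⟨u, hu⟩ := h t.toMul
          have : t = (2 : ℤ) • Additive.ofMul u := by
            rw [← ofMul_zpow]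
            apply Additive.toMul.injective
            exact hu.trans (zpow_ofNat u 2).symm
          rw [this]
          exact Submodule.smul_mem_smul (Ideal.mem_span_singleton_self _) trivial)
      refine ⟨r, ?_, fun t => ?_⟩
      · rintro rfl
        rw [Ideal.mem_span_singleton] at hr
        omega
      · have := hr' (Additive.ofMul t) trivial
        rw [← ofMul_zpow] at this
        exact this
  obtain ⟨r, hr, hr'⟩ := htor
  apply CommGroup.finite_of_fg_isMulTorsion
  intro t
  exact isOfFinOrder_iff_zpow_eq_one.mpr ⟨r, hr, hr' t⟩

variable {D : Type*} [DivisionRing D] {G M N : Subgroup Dˣ} {n s : ℕ}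

theorem mem_F {x : D} : x ∈ cent (Set.univ : Set D) ↔ ∀ y, y * x = x * y :=
  ⟨fun h y => h y trivial, fun h y _ => h y⟩

theorem val_mem_F {g : Dˣ} : (g : D) ∈ cent (Set.univ : Set D) ↔ g ∈ Subgroup.center Dˣ :=
  ⟨fun h => Subgroup.mem_center_iff.mpr fun y => ucomm (mem_F.mp h y), fun h => mem_F.mpr fun y => central_val h y⟩

theorem conj_F (g : Dˣ) : ∀ x ∈ cent (Set.univ : Set D), (g : D) * x * (g⁻¹ : Dˣ) ∈ cent (Set.univ : Set D) := by
  intro x hx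
  rw [mem_F.mp hx]
  simpa using hx

theorem F_comm : ∀ x ∈ cent (Set.univ : Set D), ∀ y ∈ cent (Set.univ : Set D), x * y = y * x :=
  fun x _ y hy => mem_F.mp hy x

/-- an element commuting with generators is central -/
theorem comm_gen {B : Subgroup Dˣ} (hcl : ∀ x, x ∈ Subfield.closure (us B)) {d : D}
    (h : ∀ b ∈ B, (b : D) * d = d * b) : d ∈ cent (Set.univ : Set D) := by
  rw [mem_F]
  intro y
  have hle : Subfield.closure (us B) ≤ cent {d} := by
    apply Subfield.closure_le.mpr
    rintro _ ⟨b, hb, rfl⟩ _ (rfl : _ = d)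
    exact (h b hb).symm
  exact (hle (hcl y) d rfl).symm

/-- simplicity of the twisted group algebra -/
theorem simple_aux {B : Subgroup Dˣ} (hcl : ∀ x, x ∈ Subfield.closure (us B))
    (hc : ∀ a ∈ B, ∀ b ∈ B, a * b * a⁻¹ * b⁻¹ ∈ Subgroup.center Dˣ)
    (I : Submodule (cent (Set.univ : Set D)) D) (hI : ∀ b ∈ B, ∀ r ∈ I, (b : D) * r * (b⁻¹ : Dˣ) ∈ I)
    (X : Finset Dˣ) : (∀ x ∈ X, x ∈ B) → ∀ r ∈ I, r ≠ 0 →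
      r ∈ Submodule.span (cent (Set.univ : Set D)) (Units.val '' (X : Set Dˣ)) → ∃ b ∈ B, (b : D) ∈ I := by
  classical
  induction X using Finset.induction_on with
  | empty => intro _ r _ h0 hr; simp at hr; exact absurd hr h0
  | insert s0 X hs0 ih =>
    intro hX r hrI hr0 hr
    have hs0B := hX s0 (Finset.mem_insert_self _ _)
    have hXB : ∀ x ∈ X, x ∈ B := fun x hx => hX x (Finset.mem_insert_of_mem hx)
    by_cases hall : ∀ b ∈ B, (b : D) * r * (b⁻¹ : Dˣ) = ((b * s0 * b⁻¹ * s0⁻¹ : Dˣ) : D) * r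
    · refine ⟨s0, hs0B, ?_⟩
      have hf : r * (s0⁻¹ : Dˣ) ∈ cent (Set.univ : Set D) := by
        apply comm_gen hcl
        intro b hb
        have h1 := hall b hb
        have hz := hc b hb s0 hs0B
        set z := b * s0 * b⁻¹ * s0⁻¹ with hzd
        have h2 : b * s0⁻¹ = z⁻¹ * s0⁻¹ * b := by
          have hz' : z⁻¹ ∈ Subgroup.center Dˣ := Subgroup.inv_mem _ hz
          rw [← Subgroup.mem_center_iff.mp hz' s0⁻¹, hzd]; group
        have h3 : (b : D) * r = z * r * b := by
          rw [← h1]; simp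
        have h4 : ((b * s0⁻¹ : Dˣ) : D) = ((z⁻¹ * s0⁻¹ * b : Dˣ) : D) := by rw [h2]
        calc (b : D) * (r * (s0⁻¹ : Dˣ)) = z * r * b * (s0⁻¹ : Dˣ) := by rw [← mul_assoc, h3]
          _ = z * r * ((b * s0⁻¹ : Dˣ) : D) := by push_cast; simp only [mul_assoc]
          _ = z * r * ((z⁻¹ * (s0⁻¹ * b) : Dˣ) : D) := by rw [h4, mul_assoc z⁻¹]
          _ = r * z * ((z⁻¹ * (s0⁻¹ * b) : Dˣ) : D) := by rw [central_val hz]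
          _ = r * ((z * (z⁻¹ * (s0⁻¹ * b)) : Dˣ) : D) := by push_cast; simp only [mul_assoc]
          _ = _ := by rw [mul_inv_cancel_left]; push_cast; simp only [mul_assoc]
      have h5 : (s0 : D) = (⟨_, hf⟩ : cent (Set.univ : Set D))⁻¹ • r := by
        rw [smul_val]
        show (s0 : D) = (r * ((s0⁻¹ : Dˣ) : D))⁻¹ * r
        rw [mul_inv_rev]
        simp [hr0]
      rw [h5]
      exact I.smul_mem _ hrI
    · push Not at hall
      obtain ⟨b, hb, hne⟩ := hall
      have hz := hc b hb s0 hs0B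
      set z := b * s0 * b⁻¹ * s0⁻¹ with hzd
      refine ih hXB ((b : D) * r * (b⁻¹ : Dˣ) - z * r) ?_ (sub_ne_zero.mpr hne) ?_
      · exact I.sub_mem (hI b hb r hrI) (I.smul_mem (⟨z, val_mem_F.mpr hz⟩ : cent (Set.univ : Set D)) hrI)
      · rw [Finset.coe_insert, Set.image_insert_eq, Submodule.mem_span_insert] at hr
        obtain ⟨c, v, hv, rfl⟩ := hr
        have h1 : (b : D) * (c • (s0 : D) + v) * (b⁻¹ : Dˣ) - z * (c • (s0 : D) + v) =
            (b : D) * v * (b⁻¹ : Dˣ) - z * v := by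
          have h2 : (b : D) * (c • (s0 : D)) * (b⁻¹ : Dˣ) = z * (c • (s0 : D)) := by
            rw [smul_val, ← mul_assoc, ← mul_assoc, mem_F.mp c.2, mem_F.mp c.2, mul_assoc, mul_assoc, mul_assoc, hzd]
            simp [mul_assoc]
          rw [mul_add, add_mul, h2, mul_add]
          abel
        rw [h1]
        refine Submodule.sub_mem _ ?_
          (Submodule.smul_mem _ (⟨z, val_mem_F.mpr hz⟩ : cent (Set.univ : Set D)) hv)
        clear h1 hne hrI hr0
        induction hv using Submodule.span_induction with
        | zero => simp
        | add x y _ _ hx hy => rw [mul_add, add_mul]; exact Submodule.add_mem _ hx hy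
        | smul l x _ hx =>
          have : (b : D) * (l • x) * (b⁻¹ : Dˣ) = l • ((b : D) * x * (b⁻¹ : Dˣ)) := by
            simp only [smul_val, ← mul_assoc]
            rw [mem_F.mp l.2]
          rw [this]; exact Submodule.smul_mem _ _ hx
        | mem x hx =>
          obtain ⟨x, hxX, rfl⟩ := hx
          have hw := hc b hb x (hXB x hxX)
          have : (b : D) * x * (b⁻¹ : Dˣ) = (⟨_, val_mem_F.mpr hw⟩ : cent (Set.univ : Set D)) • (x : D) := by
            rw [smul_val]; simp
          rw [this]
          exact Submodule.smul_mem _ _ (Submodule.subset_span ⟨x, hxX, rfl⟩)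

end DM


namespace DM
open scoped commutatorElement
set_option linter.unusedVariables false

variable {D : Type*} [DivisionRing D] {G M N : Subgroup Dˣ} {n s : ℕ}

/-- span of a group over the centre is closed under products -/
theorem span_mul_closed (H : Subgroup Dˣ) {a b : D}
    (ha : a ∈ Submodule.span (cent (Set.univ : Set D)) (us H))
    (hb : b ∈ Submodule.span (cent (Set.univ : Set D)) (us H)) :
    a * b ∈ Submodule.span (cent (Set.univ : Set D)) (us H) := by
  refine span_mul _ (us H) (us H) _ ?_ ?_ ha hb
  · rintro _ ⟨h, hh, rfl⟩; exact ⟨h, rfl, conj_F h⟩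
  · rintro _ ⟨h, hh, rfl⟩ _ ⟨h', hh', rfl⟩
    exact Submodule.subset_span ⟨h * h', H.mul_mem hh hh', by simp⟩

theorem M_le_span {B : Subgroup Dˣ} (hBn : ∀ m ∈ M, ∀ b ∈ B, m * b * m⁻¹ ∈ B)
    (hcl : ∀ x, x ∈ Subfield.closure (us B))
    (hc : ∀ a ∈ B, ∀ b ∈ B, a * b * a⁻¹ * b⁻¹ ∈ Subgroup.center Dˣ) :
    ∀ m ∈ M, (m : D) ∈ Submodule.span (cent (Set.univ : Set D)) (us B) := by
  intro m hm
  set R := Submodule.span (cent (Set.univ : Set D)) (us B) with hR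
  have hBR : ∀ b ∈ B, (b : D) ∈ R := fun b hb => Submodule.subset_span (mem_us hb)
  have hcL : ∀ h ∈ ⁅B, B⁆, (h : D) ∈ cent (Set.univ : Set D) := by
    have : ⁅B, B⁆ ≤ Subgroup.center Dˣ := Subgroup.commutator_le.mpr fun a ha b hb => hc a ha b hb
    intro h hh
    exact val_mem_F.mpr (this hh)
  obtain ⟨q, hq, hq0, hqm⟩ := ore_all _ B (fun h _ => conj_F h) hcL hcl m
  let I : Submodule (cent (Set.univ : Set D)) D := R ⊓ R.comap (rmul _ (m : D))
  have hI : ∀ b ∈ B, ∀ r ∈ I, (b : D) * r * (b⁻¹ : Dˣ) ∈ I := by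
    rintro b hb r ⟨hr1, hr2⟩
    have hr2' : r * m ∈ R := hr2
    refine ⟨span_mul_closed B (span_mul_closed B (hBR b hb) hr1) (hBR _ (B.inv_mem hb)), ?_⟩
    show (b : D) * r * (b⁻¹ : Dˣ) * m ∈ R
    have h1 := hBR _ (hBn m⁻¹ (M.inv_mem hm) b⁻¹ (B.inv_mem hb))
    have h2 := span_mul_closed B (span_mul_closed B (hBR b hb) hr2') h1
    have e : (b : D) * r * (b⁻¹ : Dˣ) * m = (b : D) * (r * m) * ((m⁻¹ * b⁻¹ * m⁻¹⁻¹ : Dˣ) : D) := by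
      simp [mul_assoc]
    rw [e]; exact h2
  have hqX : ∃ X : Finset Dˣ, (∀ x ∈ X, x ∈ B) ∧
      q ∈ Submodule.span (cent (Set.univ : Set D)) (Units.val '' (X : Set Dˣ)) := by
    rw [us, Submodule.mem_span_image_iff_exists_fun] at hq
    obtain ⟨t, ht, c, rfl⟩ := hq
    refine ⟨t, fun x hx => ht hx, ?_⟩
    exact Submodule.sum_mem _ fun i _ => Submodule.smul_mem _ _ (Submodule.subset_span ⟨i, i.2, rfl⟩)
  obtain ⟨X, hXB, hqX⟩ := hqX
  obtain ⟨b, hb, hbI⟩ := simple_aux hcl hc I hI X hXB q ⟨hq, hqm⟩ hq0 hqX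
  have h1 : (b : D) * m ∈ R := hbI.2
  have h2 := span_mul_closed B (hBR _ (B.inv_mem hb)) h1
  simpa using h2

theorem fg_sub {B : Subgroup Dˣ} (hfg : Group.FG M) (hBM : B ≤ M)
    (hM : ∀ m ∈ M, (m : D) ∈ Submodule.span (cent (Set.univ : Set D)) (us B)) :
    ∃ B₁ : Subgroup Dˣ, B₁ ≤ B ∧ Group.FG B₁ ∧
      ∀ b ∈ M, (b : D) ∈ Submodule.span (cent (Set.univ : Set D)) (us B₁) := by
  classical
  have hfg' : M.FG := (Group.fg_iff_subgroup_fg M).mp hfg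
  obtain ⟨X, hX⟩ := hfg'
  have hXM : ∀ x ∈ X, x ∈ M := fun x hx => by rw [← hX]; exact Subgroup.subset_closure hx
  have key : ∀ m ∈ M, ∃ Y : Finset Dˣ, (∀ x ∈ Y, x ∈ B) ∧
      (m : D) ∈ Submodule.span (cent (Set.univ : Set D)) (Units.val '' (Y : Set Dˣ)) := by
    intro m hm
    have hq := hM m hm
    rw [us, Submodule.mem_span_image_iff_exists_fun] at hq
    obtain ⟨t, ht, c, hc⟩ := hq
    refine ⟨t, fun x hx => ht hx, ?_⟩
    rw [← hc]
    exact Submodule.sum_mem _ fun i _ => Submodule.smul_mem _ _ (Submodule.subset_span ⟨i, i.2, rfl⟩)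
  choose! Y hYB hY using key
  let W : Finset Dˣ := X.biUnion (fun x => Y x ∪ Y x⁻¹)
  refine ⟨Subgroup.closure (W : Set Dˣ), ?_, ?_, ?_⟩
  · rw [Subgroup.closure_le]
    intro w hw
    obtain ⟨x, hx, hw⟩ := Finset.mem_biUnion.mp (Finset.mem_coe.mp hw)
    rcases Finset.mem_union.mp hw with h | h
    · exact hYB x (hXM x hx) w h
    · exact hYB x⁻¹ (M.inv_mem (hXM x hx)) w h
  · exact (Group.fg_iff_subgroup_fg _).mpr ⟨W, rfl⟩
  · set R := Submodule.span (cent (Set.univ : Set D)) (us (Subgroup.closure (W : Set Dˣ))) with hR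
    let Q : Subgroup Dˣ := {
      carrier := {m | (m : D) ∈ R ∧ ((m⁻¹ : Dˣ) : D) ∈ R}
      mul_mem' := by
        rintro a b ⟨ha, ha'⟩ ⟨hb, hb'⟩
        refine ⟨by push_cast; exact span_mul_closed _ ha hb, ?_⟩
        rw [mul_inv_rev]
        push_cast
        have := span_mul_closed _ hb' ha'
        simpa using this
      one_mem' := by
        have : ((1 : Dˣ) : D) ∈ R := Submodule.subset_span (mem_us (Subgroup.one_mem _))
        exact ⟨this, by rw [inv_one]; exact this⟩
      inv_mem' := by
        rintro a ⟨ha, ha'⟩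
        exact ⟨ha', by rw [inv_inv]; exact ha⟩ }
    have hMQ : M ≤ Q := by
      rw [← hX, Subgroup.closure_le]
      intro x hx
      constructor
      · refine Submodule.span_mono (Set.image_mono ?_) (hY x (hXM x hx))
        intro y hy
        exact Subgroup.subset_closure (Finset.mem_coe.mpr (Finset.mem_biUnion.mpr ⟨x, hx, Finset.mem_union_left _ hy⟩))
      · refine Submodule.span_mono (Set.image_mono ?_) (hY x⁻¹ (M.inv_mem (hXM x hx)))
        intro y hy
        exact Subgroup.subset_closure (Finset.mem_coe.mpr (Finset.mem_biUnion.mpr ⟨x, hx, Finset.mem_union_right _ hy⟩))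
    exact fun b hb => (hMQ hb).1

/-- elements of `B` which are squares modulo the centre -/
def sqSub (B : Subgroup Dˣ) (hc : ∀ a ∈ B, ∀ b ∈ B, a * b * a⁻¹ * b⁻¹ ∈ Subgroup.center Dˣ) :
    Subgroup Dˣ where
  carrier := {x | x ∈ B ∧ ∃ b ∈ B, x * (b * b)⁻¹ ∈ Subgroup.center Dˣ}
  mul_mem' := by
    rintro x y ⟨hx, a, ha, hxa⟩ ⟨hy, b, hb, hyb⟩
    refine ⟨B.mul_mem hx hy, a * b, B.mul_mem ha hb, ?_⟩
    set z := x * (a * a)⁻¹ with hz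
    set w := y * (b * b)⁻¹ with hw
    have hu := hc a ha b hb
    have e : x * y * (a * b * (a * b))⁻¹ = z * (a * a * w * (a * a)⁻¹) * (a * (a * b * a⁻¹ * b⁻¹) * a⁻¹) := by
      rw [hz, hw]; group
    rw [e]
    have hnorm : (Subgroup.center Dˣ).Normal := inferInstance
    exact Subgroup.mul_mem _ (Subgroup.mul_mem _ hxa (hnorm.conj_mem _ hyb _)) (hnorm.conj_mem _ hu _)
  one_mem' := ⟨B.one_mem, 1, B.one_mem, by simp⟩
  inv_mem' := by
    rintro x ⟨hx, a, ha, hxa⟩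
    refine ⟨B.inv_mem hx, a⁻¹, B.inv_mem ha, ?_⟩
    have hnorm : (Subgroup.center Dˣ).Normal := inferInstance
    have e : x⁻¹ * (a⁻¹ * a⁻¹)⁻¹ = (a * a)⁻¹ * (x * (a * a)⁻¹)⁻¹ * ((a * a)⁻¹)⁻¹ := by group
    rw [e]
    exact hnorm.conj_mem _ (Subgroup.inv_mem _ hxa) _

theorem Setup.case2 (S : Setup G M N n s) (hfg : Group.FG M)
    (hab : ∀ A : Subgroup Dˣ, A ≤ M → (∀ m ∈ M, ∀ a ∈ A, m * a * m⁻¹ ∈ A) →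
      (∀ x ∈ A, ∀ y ∈ A, x * y = y * x) → A ≤ Subgroup.center Dˣ) :
    ∃ L : Subfield D, (∀ x ∈ L, ∀ y ∈ L, x * y = y * x) ∧ Module.Finite L D := by
  classical
  refine ⟨cent Set.univ, F_comm, ?_⟩
  have hex : ∃ j, iterD N j ≤ Subgroup.center Dˣ := ⟨s, by rw [S.sol]; exact bot_le⟩
  obtain ⟨j, hj, hmin⟩ : ∃ j, iterD N j ≤ Subgroup.center Dˣ ∧ ∀ i < j, ¬ iterD N i ≤ Subgroup.center Dˣ :=
    ⟨Nat.find hex, Nat.find_spec hex, fun i hi => Nat.find_min hex hi⟩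
  cases j with
  | zero =>
    refine fd_lemma _ M (fun h _ => conj_F h) ?_ S.genM
    intro h0
    refine S.ind (Subgroup.relIndex_eq_zero_of_le_left (fun g hg => ?_) h0)
    exact ⟨S.NM hg, val_mem_F.mpr (hj hg)⟩
  | succ j =>
    set B := iterD N j with hB
    have hBM : B ≤ M := (iterD_le N j).trans S.NM
    have hBn : ∀ m ∈ M, ∀ p ∈ B, m * p * m⁻¹ ∈ B := fun m hm p hp =>
        conj_iterD_mem S.Nn j m hm p hp
    have hc : ∀ a ∈ B, ∀ b ∈ B, a * b * a⁻¹ * b⁻¹ ∈ Subgroup.center Dˣ := fun a ha b hb =>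
      hj (Subgroup.commutator_mem_commutator ha hb)
    have hBnc : ¬ B ≤ Subgroup.center Dˣ := hmin j (Nat.lt_succ_self j)
    have hcl : ∀ x, x ∈ Subfield.closure (us B) := S.gen B hBM hBn (fun h => hBnc (hab B hBM hBn h))
    have hcp : CP (cent (Set.univ : Set D)) B := by
      refine CP_case2 (fun x => mem_F) B (fun g hg h hh => val_mem_F.mpr (hc g hg h hh)) ?_
      intro g hg
      exact comm_gen hcl fun b hb => (val_comm (hg b hb)).symm
    obtain ⟨B₁, hB₁, hB₁fg, hspan⟩ := fg_sub hfg hBM (M_le_span hBn hcl hc)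
    have hcos : ∀ b ∈ B, ∃ b₁ ∈ B₁, b * b₁⁻¹ ∈ Subgroup.center Dˣ := by
      intro b hb
      by_contra hcon
      push Not at hcon
      have hd := hcp {b} (B₁ : Set Dˣ) (by simpa using hb) hB₁ (by
        rintro _ rfl b₁ hb₁ h
        exact hcon b₁ hb₁ (val_mem_F.mp h))
      exact b.ne_zero (Submodule.disjoint_def.mp hd _ (Submodule.subset_span ⟨b, rfl, rfl⟩) (hspan b (hBM hb)))
    have hsq : (∀ b ∈ B, b * b ∈ Subgroup.center Dˣ) ∨
        (∀ b ∈ B, ∃ a ∈ B, b * (a * a)⁻¹ ∈ Subgroup.center Dˣ) := by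
      let H := sqSub B hc
      have hHB : H ≤ B := fun x hx => hx.1
      have hHn : ∀ m ∈ M, ∀ h ∈ H, m * h * m⁻¹ ∈ H := by
        rintro m hm h ⟨hh, a, ha, hz⟩
        refine ⟨hBn m hm h hh, m * a * m⁻¹, hBn m hm a ha, ?_⟩
        have e : m * h * m⁻¹ * (m * a * m⁻¹ * (m * a * m⁻¹))⁻¹ = m * (h * (a * a)⁻¹) * m⁻¹ := by group
        rw [e]
        have hnorm : (Subgroup.center Dˣ).Normal := inferInstance
        exact hnorm.conj_mem _ hz _
      by_cases hHab : ∀ x ∈ H, ∀ y ∈ H, x * y = y * x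
      · left
        intro b hb
        exact hab H (hHB.trans hBM) hHn hHab ⟨B.mul_mem hb hb, b, hb, by simp⟩
      · right
        have hcH : ∀ h ∈ ⁅H, H⁆, (h : D) ∈ cent (Set.univ : Set D) := by
          intro h hh
          exact val_mem_F.mpr (hj (Subgroup.commutator_mono hHB hHB hh))
        have := lemX hcp hHB (fun g hg hgF => ⟨hg, 1, B.one_mem, by simpa using val_mem_F.mp hgF⟩)
          (fun h _ => conj_F h) hcH (S.gen H (hHB.trans hBM) hHn hHab)
        exact fun b hb => (this hb).2
    have hrel : (Subgroup.center Dˣ).relIndex B ≠ 0 := by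
      apply Subgroup.index_ne_zero_iff_finite.mpr
      let Z' := (Subgroup.center Dˣ).subgroupOf B
      let π : B →* B ⧸ Z' := QuotientGroup.mk' Z'
      have hπ : ∀ x y : B, (x : Dˣ) * (y : Dˣ)⁻¹ ∈ Subgroup.center Dˣ → π x = π y := by
        intro x y h
        have h1 : x * y⁻¹ ∈ Z' := h
        have h2 : π (x * y⁻¹) = 1 := (QuotientGroup.eq_one_iff _).mpr h1
        rw [map_mul, map_inv] at h2
        exact mul_inv_eq_one.mp h2
      let inst : CommGroup (B ⧸ Z') := { (inferInstance : Group (B ⧸ Z')) with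
        mul_comm := by
          intro a b
          obtain ⟨x, rfl⟩ := QuotientGroup.mk'_surjective Z' a
          obtain ⟨y, rfl⟩ := QuotientGroup.mk'_surjective Z' b
          have := hπ (x * y) (y * x) (by
            have := hc x x.2 y y.2
            simpa [mul_assoc] using this)
          simpa [π] using this }
      have : Group.FG (B ⧸ Z') := by
        refine Group.fg_of_surjective (f := π.comp (Subgroup.inclusion hB₁)) ?_
        intro q
        obtain ⟨x, rfl⟩ := QuotientGroup.mk'_surjective Z' q
        obtain ⟨b₁, hb₁, h⟩ := hcos x x.2
        exact ⟨⟨b₁, hb₁⟩, (hπ x ⟨b₁, hB₁ hb₁⟩ h).symm⟩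
      apply fin_comm (T := B ⧸ Z')
      rcases hsq with h | h
      · left
        intro t
        obtain ⟨x, rfl⟩ := QuotientGroup.mk'_surjective Z' t
        have h1 : π (x * x) = π 1 := hπ (x * x) 1 (by simpa using h x x.2)
        rw [map_mul, map_one] at h1
        rw [pow_two]; exact h1
      · right
        intro t
        obtain ⟨x, rfl⟩ := QuotientGroup.mk'_surjective Z' t
        obtain ⟨a, ha, h1⟩ := h x x.2
        refine ⟨π ⟨a, ha⟩, ?_⟩
        rw [pow_two]
        have h2 := hπ x (⟨a, ha⟩ * ⟨a, ha⟩) h1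
        rw [map_mul] at h2
        exact h2
    refine fd_lemma _ B (fun h _ => conj_F h) ?_ hcl
    intro h0
    apply hrel
    rw [← Subgroup.inf_relIndex_right]
    have hle : Subgroup.center Dˣ ⊓ B ≤ unitsIn (cent (Set.univ : Set D)) B :=
      fun g hg => ⟨hg.2, val_mem_F.mpr hg.1⟩
    exact Subgroup.relIndex_eq_zero_of_le_left hle h0

theorem Setup.fd (S : Setup G M N n s) (hfg : Group.FG M) :
    ∃ L : Subfield D, (∀ x ∈ L, ∀ y ∈ L, x * y = y * x) ∧ Module.Finite L D := by
  by_cases h : ∀ A : Subgroup Dˣ, A ≤ M → (∀ m ∈ M, ∀ a ∈ A, m * a * m⁻¹ ∈ A) →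
      (∀ x ∈ A, ∀ y ∈ A, x * y = y * x) → A ≤ Subgroup.center Dˣ
  · exact S.case2 hfg h
  · push Not at h
    obtain ⟨A, h1, h2, h3, h4⟩ := h
    exact S.case1 A h1 h2 h3 h4

end DM


namespace DM
open scoped commutatorElement
set_option linter.unusedVariables false

theorem int_jacobson : IsJacobsonRing ℤ := by
  rw [isJacobsonRing_iff_prime_eq]
  intro P hP
  by_cases h : P = ⊥
  · subst h
    refine le_antisymm ?_ Ideal.le_jacobson
    intro x hx
    have h1 := Ideal.mem_jacobson_bot.1 hx x
    rw [Int.isUnit_iff] at h1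
    have : x = 0 := by
      rcases h1 with h1 | h1
      · have : x * x = 0 := by linarith
        simpa using this
      · nlinarith [mul_self_nonneg x]
    simpa using this
  · have : P.IsMaximal := hP.isMaximal h
    exact Ideal.jacobson_eq_self_of_isMaximal

theorem finite_field_of_finiteType (k : Type*) [Field k] [Algebra.FiniteType ℤ k] :
    Finite k := by
  have := int_jacobson
  have hf : Module.Finite ℤ k := finite_of_finite_type_of_isJacobsonRing ℤ k
  have hn : ∃ n : ℤ, n ≠ 0 ∧ (n : k) = 0 := by
    by_contra hc
    push Not at hc
    have hinj : Function.Injective (algebraMap ℤ k) := by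
      rw [injective_iff_map_eq_zero]
      intro a ha
      by_contra h0
      exact hc a h0 (by simpa using ha)
    have : IsField ℤ := isField_of_isIntegral_of_isField hinj (Field.toIsField k)
    obtain ⟨b, hb⟩ := this.mul_inv_cancel (a := 2) (by norm_num)
    omega
  obtain ⟨n, hn, hk⟩ := hn
  apply Module.finite_of_fg_torsion
  intro x
  refine ⟨⟨n, mem_nonZeroDivisors_of_ne_zero hn⟩, ?_⟩
  show n • x = 0
  rw [zsmul_eq_mul, hk, zero_mul]

theorem finite_field_of_finiteType' (k : Type*) [Field k] (i : Algebra ℤ k)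
    (h : Algebra.FiniteType ℤ k) : Finite k := by
  obtain rfl : i = Ring.toIntAlgebra k := Subsingleton.elim _ _
  exact finite_field_of_finiteType k

theorem exists_max_notMem (A : Type*) [CommRing A] [IsDomain A] [Algebra.FiniteType ℤ A]
    (a : A) (ha : a ≠ 0) : ∃ m : Ideal A, m.IsMaximal ∧ a ∉ m := by
  have := int_jacobson
  have hJ : IsJacobsonRing A := isJacobsonRing_of_finiteType (A := ℤ)
  have h := hJ.out (I := ⊥) (Ideal.isPrime_bot.isRadical)
  by_contra hc
  push Not at hc
  have : a ∈ (⊥ : Ideal A).jacobson := by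
    rw [Ideal.jacobson, Ideal.mem_sInf]
    rintro m ⟨-, hm⟩
    exact hc m hm
  rw [h] at this
  exact ha (by simpa using this)

theorem residually_finite {Γ : Type*} [Group Γ] (hfg : Group.FG Γ) {r : ℕ} {K : Type*} [Field K]
    (ρ : Γ →* Matrix (Fin r) (Fin r) K) (hρ : Function.Injective ρ) (g : Γ) (hg : g ≠ 1) :
    ∃ Q : Subgroup Γ, Q.Normal ∧ Q.FiniteIndex ∧ g ∉ Q := by
  obtain ⟨X, hX, hXf⟩ := Group.fg_iff.1 hfg
  let E : Set K := ⋃ x ∈ X, ⋃ i : Fin r, ⋃ j : Fin r, {ρ x i j, ρ x⁻¹ i j}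
  have hE : E.Finite := hXf.biUnion fun x _ => Set.finite_iUnion fun i =>
    Set.finite_iUnion fun j => by simp
  let A := Algebra.adjoin ℤ E
  have hA : Algebra.FiniteType ℤ A := Algebra.FiniteType.adjoin_of_finite hE
  have hent : ∀ γ : Γ, ∀ i j, ρ γ i j ∈ A := by
    intro γ
    have hγ : γ ∈ Subgroup.closure X := by rw [hX]; trivial
    have hgen : ∀ x ∈ X, ∀ i j, ρ x i j ∈ A ∧ ρ x⁻¹ i j ∈ A := by
      intro x hx i j
      constructor <;> refine Algebra.subset_adjoin ?_ <;>
        exact Set.mem_biUnion hx (Set.mem_iUnion.2 ⟨i, Set.mem_iUnion.2 ⟨j, by simp⟩⟩)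
    have hmul : ∀ a b, (∀ i j, ρ a i j ∈ A) → (∀ i j, ρ b i j ∈ A) → ∀ i j, ρ (a * b) i j ∈ A := by
      intro a b ha hb i j
      rw [map_mul, Matrix.mul_apply]
      exact A.sum_mem fun k _ => A.mul_mem (ha i k) (hb k j)
    induction hγ using Subgroup.closure_induction'' with
    | one =>
      intro i j
      rw [map_one, Matrix.one_apply]
      split_ifs
      · exact A.one_mem
      · exact A.zero_mem
    | mem x hx => exact fun i j => (hgen x hx i j).1
    | inv_mem x hx => exact fun i j => (hgen x hx i j).2
    | mul a b _ _ ha hb => exact hmul a b ha hb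
  let ρA : Γ →* Matrix (Fin r) (Fin r) A :=
    { toFun := fun γ => Matrix.of fun i j => ⟨ρ γ i j, hent γ i j⟩
      map_one' := by
        ext i j
        simp only [map_one, Matrix.of_apply, Matrix.one_apply]
        split_ifs <;> rfl
      map_mul' := by
        intro a b
        ext i j
        simp [Matrix.mul_apply] }
  have hne : ρ g ≠ 1 := fun h => hg (hρ (by rw [h, map_one]))
  obtain ⟨i, j, hij⟩ : ∃ i j, ρA g i j - (1 : Matrix (Fin r) (Fin r) A) i j ≠ 0 := by
    by_contra hc
    push Not at hc
    apply hne
    have h1 : ρA g = 1 := by ext i j; rw [sub_eq_zero.1 (hc i j)]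
    ext i j
    have := congrArg (fun m : Matrix (Fin r) (Fin r) A => ((m i j : A) : K)) h1
    simp only [Matrix.one_apply] at this ⊢
    refine this.trans ?_
    split_ifs <;> rfl
  obtain ⟨m, hm, ham⟩ := exists_max_notMem A _ hij
  let _ : Field (A ⧸ m) := Ideal.Quotient.field m
  have : Algebra.FiniteType ℤ (A ⧸ m) :=
    Algebra.FiniteType.of_surjective (Ideal.Quotient.mkₐ ℤ m) (Ideal.Quotient.mkₐ_surjective ℤ m)
  have hfin : Finite (A ⧸ m) := finite_field_of_finiteType' _ _ this
  let φ : Γ →* Matrix (Fin r) (Fin r) (A ⧸ m) :=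
    ((Ideal.Quotient.mk m).mapMatrix.toMonoidHom).comp ρA
  have : Finite (Matrix (Fin r) (Fin r) (A ⧸ m))ˣ := inferInstance
  refine ⟨φ.toHomUnits.ker, inferInstance, Subgroup.finiteIndex_ker _, ?_⟩
  intro hk
  rw [MonoidHom.mem_ker] at hk
  have h1 : φ g = 1 := by
    have := congrArg Units.val hk
    simpa using this
  apply ham
  rw [← Ideal.Quotient.eq_zero_iff_mem, map_sub, sub_eq_zero]
  have h2 := congrFun (congrFun h1 i) j
  refine h2.trans ?_
  simp only [Matrix.one_apply]
  split_ifs <;> simp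

theorem rf_units {D : Type*} [DivisionRing D] (G : Subgroup Dˣ) (hfg : Group.FG G)
    (L : Subfield D) (hL : ∀ x ∈ L, ∀ y ∈ L, x * y = y * x) (hfin : Module.Finite L D)
    (g : G) (hg : g ≠ 1) : ∃ Q : Subgroup G, Q.Normal ∧ Q.FiniteIndex ∧ g ∉ Q := by
  let iF : Field L := { (inferInstance : DivisionRing L) with
    mul_comm := fun a b => Subtype.ext (hL a a.2 b b.2) }
  let b : Module.Basis (Fin (Module.finrank L D)) L D := Module.finBasis L D
  let e := LinearMap.toMatrixAlgEquiv b
  let ρ : G →* Module.End L D :=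
    { toFun := fun g => rmul L ((g⁻¹ : G) : Dˣ)
      map_one' := by ext d; simp [rmul_apply]
      map_mul' := by intro x y; ext d; simp [rmul_apply, mul_assoc] }
  refine residually_finite hfg ((e.toRingEquiv.toRingHom.toMonoidHom).comp ρ) ?_ g hg
  intro x y hxy
  have h1 : ρ x = ρ y := e.injective hxy
  have h2 := LinearMap.congr_fun h1 1
  have h3 : (((x⁻¹ : G) : Dˣ) : D) = ((y⁻¹ : G) : Dˣ) := by
    simpa [ρ, rmul_apply] using h2
  exact inv_injective (Subtype.ext (Units.ext h3))

end DM


namespace DM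
open scoped commutatorElement
set_option linter.unusedVariables false

theorem iterD_map {Γ Δ : Type*} [Group Γ] [Group Δ] (f : Γ →* Δ) (N : Subgroup Γ) (k : ℕ) :
    (iterD N k).map f = iterD (N.map f) k := by
  induction k with
  | zero => rfl
  | succ k ih =>
    show (⁅iterD N k, iterD N k⁆).map f = ⁅iterD (N.map f) k, iterD (N.map f) k⁆
    rw [Subgroup.map_commutator, ih]

theorem abs_rf {Γ : Type*} [Group Γ] (M N : Subgroup Γ) (s : ℕ) (hNM : N ≤ M)
    (hind : N.relIndex M ≠ 0) (hsol : iterD N s = ⊥)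
    (hsup : ∀ Q : Subgroup Γ, Q.Normal → Q.FiniteIndex → M ⊔ Q = ⊤)
    (hrf : ∀ g : Γ, g ≠ 1 → ∃ Q : Subgroup Γ, Q.Normal ∧ Q.FiniteIndex ∧ g ∉ Q) :
    ∃ Q : Subgroup Γ, Q.Normal ∧ Q.FiniteIndex ∧ iterD Q s = ⊥ := by
  have hbound : ∀ Q : Subgroup Γ, Q.Normal → Q.FiniteIndex → (N ⊔ Q).index ≤ N.relIndex M := by
    intro Q hQ hQf
    let f : M →* Γ ⧸ Q := (QuotientGroup.mk' Q).comp M.subtype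
    have hsurj : Function.Surjective f := by
      intro y
      obtain ⟨g, rfl⟩ := QuotientGroup.mk'_surjective Q y
      have hg : g ∈ M ⊔ Q := by rw [hsup Q hQ hQf]; trivial
      obtain ⟨m, hm, q, hq, rfl⟩ := Subgroup.mem_sup_of_normal_right.1 hg
      refine ⟨⟨m, hm⟩, ?_⟩
      show QuotientGroup.mk' Q m = _
      rw [map_mul]
      have : QuotientGroup.mk' Q q = 1 := by simpa using hq
      rw [this, mul_one]
    have h1 : ((N.subgroupOf M).map f) = (N ⊔ Q).map (QuotientGroup.mk' Q) := by
      rw [Subgroup.map_sup, ← Subgroup.map_map, Subgroup.map_subgroupOf_eq_of_le hNM]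
      have : Q.map (QuotientGroup.mk' Q) = ⊥ := by simp
      rw [this, sup_bot_eq]
    have h2 : ((N ⊔ Q).map (QuotientGroup.mk' Q)).index = (N ⊔ Q).index :=
      Subgroup.index_map_eq _ (QuotientGroup.mk'_surjective Q) (by simp)
    have h3 := Subgroup.index_map_dvd (N.subgroupOf M) hsurj
    rw [h1, h2] at h3
    exact Nat.le_of_dvd (Nat.pos_of_ne_zero hind) h3
  let V : Set ℕ := {v | ∃ Q : Subgroup Γ, Q.Normal ∧ Q.FiniteIndex ∧ (N ⊔ Q).index = v}
  have hVb : BddAbove V := ⟨N.relIndex M, by rintro v ⟨Q, h1, h2, rfl⟩; exact hbound Q h1 h2⟩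
  have hVn : V.Nonempty := ⟨_, ⊤, inferInstance, inferInstance, rfl⟩
  obtain ⟨Q₀, hn, hf, hv⟩ := Nat.sSup_mem hVn hVb
  refine ⟨Q₀, hn, hf, ?_⟩
  have key : ∀ Q : Subgroup Γ, Q.Normal → Q.FiniteIndex → iterD Q₀ s ≤ Q := by
    intro Q hQ hQf
    have hle : N ⊔ (Q ⊓ Q₀) ≤ N ⊔ Q₀ := sup_le_sup_left inf_le_right _
    have h1 : (N ⊔ (Q ⊓ Q₀)).index ≤ (N ⊔ Q₀).index := by
      rw [hv]
      exact le_csSup hVb ⟨Q ⊓ Q₀, inferInstance, inferInstance, rfl⟩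
    have hfi : (N ⊔ (Q ⊓ Q₀)).FiniteIndex := Subgroup.finiteIndex_of_le (le_sup_right : Q ⊓ Q₀ ≤ _)
    have h2 := Subgroup.relIndex_mul_index hle
    have h3 : (N ⊔ (Q ⊓ Q₀)).relIndex (N ⊔ Q₀) = 1 := by
      have h4 : (N ⊔ (Q ⊓ Q₀)).index ≠ 0 := hfi.index_ne_zero
      set a := (N ⊔ (Q ⊓ Q₀)).relIndex (N ⊔ Q₀)
      rcases Nat.lt_or_ge a 2 with h | h
      · interval_cases a
        · omega
        · rfl
      · have h5 := Nat.pos_of_ne_zero h4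
        nlinarith
    have h4 : N ⊔ Q₀ ≤ N ⊔ (Q ⊓ Q₀) := Subgroup.relIndex_eq_one.1 h3
    have h5 : Q₀ ≤ N ⊔ Q := le_trans le_sup_right (h4.trans (sup_le_sup_left inf_le_left _))
    have h6 : (iterD (N ⊔ Q) s).map (QuotientGroup.mk' Q) = ⊥ := by
      rw [iterD_map, Subgroup.map_sup]
      have : Q.map (QuotientGroup.mk' Q) = ⊥ := by simp
      rw [this, sup_bot_eq, ← iterD_map, hsol, Subgroup.map_bot]
    rw [Subgroup.map_eq_bot_iff, QuotientGroup.ker_mk'] at h6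
    exact (iterD_mono h5 s).trans h6
  rw [eq_bot_iff]
  intro g hg
  by_contra hne
  obtain ⟨Q, h1, h2, h3⟩ := hrf g hne
  exact h3 (key Q h1 h2 hg)

variable {D : Type*} [DivisionRing D] {G M N : Subgroup Dˣ} {n s : ℕ}

theorem Setup.G_not_central (S : Setup G M N n s) : ¬ G ≤ Subgroup.center Dˣ := by
  intro h
  apply S.nonab
  intro x hx y hy
  exact ((Subgroup.mem_center_iff.1 (h (S.le hx))) y).symm

theorem sn_map {Q : Subgroup G} (hG : SN n G) (hQ : Q.Normal) : SN (n + 1) (Q.map G.subtype) := by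
  refine ⟨G, hG, ?_, ?_⟩
  · rintro _ ⟨q, -, rfl⟩; exact q.2
  · rintro k hk _ ⟨q, hq, rfl⟩
    exact ⟨⟨k, hk⟩ * q * ⟨k, hk⟩⁻¹, hQ.conj_mem q hq _, rfl⟩

theorem not_central_map (S : Setup G M N n s) {Q : Subgroup G} (hf : Q.FiniteIndex)
    (hc : Q.map G.subtype ≤ Subgroup.center Dˣ) : False := by
  apply S.G_not_central
  refine CF n G S.sn ?_
  intro h0
  have h1 := Subgroup.relIndex_dvd_of_le_left G hc
  rw [h0] at h1
  have h2 : (Q.map G.subtype).relIndex G = Q.index := by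
    show ((Q.map G.subtype).subgroupOf G).index = _
    rw [Subgroup.subgroupOf, Subgroup.comap_map_eq_self_of_injective G.subtype_injective]
  rw [h2] at h1
  exact hf.index_ne_zero (by simpa using h1)

theorem Setup.contra (S : Setup G M N n s) (hfg : Group.FG M) : False := by
  obtain ⟨L, hL, hfin⟩ := S.fd hfg
  have hGfg : Group.FG G := by
    obtain ⟨x, hx, hxM⟩ : ∃ x ∈ G, x ∉ M := by
      by_contra hc
      push Not at hc
      exact S.ne (le_antisymm S.le hc)
    have h1 : M ⊔ Subgroup.zpowers x = G := by
      rcases S.max (M ⊔ Subgroup.zpowers x) le_sup_left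
        (sup_le S.le (by simpa using hx)) with h | h
      · exfalso
        apply hxM
        rw [← h]
        exact (le_sup_right : Subgroup.zpowers x ≤ _) (Subgroup.mem_zpowers x)
      · exact h
    rw [Group.fg_iff_subgroup_fg] at hfg ⊢
    rw [← h1]
    exact hfg.sup ⟨{x}, by simp [Subgroup.zpowers_eq_closure]⟩
  obtain ⟨Q, hQn, hQf, hQ⟩ := abs_rf (M.subgroupOf G) (N.subgroupOf G) s
    (Subgroup.comap_mono S.NM)
    (by rw [Subgroup.relIndex_subgroupOf S.le]; exact S.ind)
    (by
      have := iterD_map G.subtype (N.subgroupOf G) s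
      rw [Subgroup.map_subgroupOf_eq_of_le (S.NM.trans S.le), S.sol] at this
      exact (Subgroup.map_eq_bot_iff_of_injective _ G.subtype_injective).1 this)
    (by
      intro Q hQn hQf
      have hle : Q.map G.subtype ≤ G := by rintro _ ⟨q, -, rfl⟩; exact q.2
      rcases S.max (M ⊔ Q.map G.subtype) le_sup_left (sup_le S.le hle) with h | h
      · exfalso
        have hQM : Q.map G.subtype ≤ M := by rw [← h]; exact le_sup_right
        refine not_central_map S hQf ?_
        refine S2 (sn_map S.sn hQn) (N := N ⊓ Q.map G.subtype) inf_le_right ?_ s ?_ ?_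
        · intro k hk x hx
          exact ⟨S.Nn k (hQM hk) x hx.1,
            Subgroup.mul_mem _ (Subgroup.mul_mem _ hk hx.2) (Subgroup.inv_mem _ hk)⟩
        · have := iterD_mono (inf_le_left : N ⊓ Q.map G.subtype ≤ N) s
          rw [S.sol] at this
          exact this.trans bot_le
        · rw [Subgroup.inf_relIndex_right]
          exact fun h0 => S.ind (Subgroup.relIndex_eq_zero_of_le_right hQM h0)
      · apply Subgroup.map_injective G.subtype_injective
        rw [Subgroup.map_sup, Subgroup.map_subgroupOf_eq_of_le S.le, h, ← MonoidHom.range_eq_map,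
          Subgroup.range_subtype])
    (fun g hg => rf_units G hGfg L hL hfin g hg)
  refine not_central_map S hQf (Sol (sn_map S.sn hQn) s ?_)
  rw [← iterD_map, hQ, Subgroup.map_bot]
  exact bot_le

end DM


namespace DM
open scoped commutatorElement
set_option linter.unusedVariables false

theorem iterD_derived {Γ : Type*} [Group Γ] (k : ℕ) : iterD (⊤ : Subgroup Γ) k = derivedSeries Γ k := by
  induction k with
  | zero => rfl
  | succ k ih =>
    show ⁅iterD (⊤ : Subgroup Γ) k, iterD (⊤ : Subgroup Γ) k⁆ = _
    rw [ih]; rfl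

theorem part1 {D : Type*} [DivisionRing D]
    (G M : Subgroup Dˣ) (hG : IsSubnormal G)
    (hmax : M < G ∧ ∀ H : Subgroup Dˣ, M ≤ H → H ≤ G → H = M ∨ H = G)
    (hnonab : ¬ ∀ x ∈ M, ∀ y ∈ M, x * y = y * x) (hfg : Group.FG ↥M)
    (hs : IsSolvableByFinite ↥M) : False := by
  obtain ⟨k, c, h0, h1, h2⟩ := hG
  have hsn : SN k G := by
    rw [← h0]
    refine sn_of_isSubnormal_aux k c h1 ?_
    exact h2
  obtain ⟨N, hN, ⟨s, hsol⟩, hfin⟩ := hs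
  have hsolN : iterD N s = ⊥ := by
    have := iterD_map N.subtype ⊤ s
    rw [iterD_derived, hsol, Subgroup.map_bot, ← MonoidHom.range_eq_map,
      Subgroup.range_subtype] at this
    exact this.symm
  have S : Setup G M (N.map M.subtype) k s :=
    { sn := hsn
      le := hmax.1.le
      ne := hmax.1.ne
      max := hmax.2
      NM := by rintro _ ⟨q, -, rfl⟩; exact q.2
      Nn := by
        rintro m hm _ ⟨q, hq, rfl⟩
        exact ⟨⟨m, hm⟩ * q * ⟨m, hm⟩⁻¹, hN.conj_mem q hq _, rfl⟩
      sol := by rw [← iterD_map, hsolN, Subgroup.map_bot]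
      ind := by
        have h2 : (N.map M.subtype).relIndex M = N.index := by
          show ((N.map M.subtype).subgroupOf M).index = _
          rw [Subgroup.subgroupOf, Subgroup.comap_map_eq_self_of_injective M.subtype_injective]
        rw [h2]
        exact Subgroup.index_ne_zero_iff_finite.2 hfin
      nonab := hnonab }
  exact S.contra hfg

theorem polycyclic_aux {Γ : Type*} [Group Γ] (h : IsPolycyclic Γ) : Group.FG Γ ∧ IsSolvable Γ := by
  obtain ⟨k, s, h0, hk, hs⟩ := h
  have key : ∀ i ≤ k, (s i).FG ∧ iterD (s i) i = ⊥ := by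
    intro i
    induction i with
    | zero =>
      intro _
      rw [h0]
      exact ⟨Subgroup.FG.bot, rfl⟩
    | succ i ih =>
      intro hi
      obtain ⟨hfg, hsol⟩ := ih (by omega)
      obtain ⟨hle, hnor, g, hg, hgen⟩ := hs i (by omega)
      constructor
      · have : s (i + 1) = s i ⊔ Subgroup.zpowers g := by
          refine le_antisymm ?_ (sup_le hle (by simpa using hg))
          intro x hx
          obtain ⟨m, hm⟩ := hgen x hx
          have := Subgroup.mul_mem_sup hm (Subgroup.zpow_mem_zpowers g m)
          simpa using this
        rw [this]
        exact hfg.sup ⟨{g}, by simp [Subgroup.zpowers_eq_closure]⟩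
      · have hconj : ∀ a ∈ s (i+1), ∀ x ∈ s i, a * x * a⁻¹ ∈ s i := by
          intro a ha x hx
          have := hnor.conj_mem ⟨x, hle hx⟩ (by simpa [Subgroup.mem_subgroupOf] using hx) ⟨a, ha⟩
          simpa [Subgroup.mem_subgroupOf] using this
        have hcomm : ⁅s (i+1), s (i+1)⁆ ≤ s i := by
          let Q := (s i).subgroupOf (s (i+1))
          let π := QuotientGroup.mk' Q
          rw [Subgroup.commutator_le]
          intro x hx y hy
          have hz : ∀ z (hz : z ∈ s (i+1)), ∃ m : ℤ, π ⟨z, hz⟩ = π ⟨g, hg⟩ ^ m := by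
            intro z hz
            obtain ⟨m, hm⟩ := hgen z hz
            refine ⟨m, ?_⟩
            have h1 : π (⟨z, hz⟩ * (⟨g, hg⟩ ^ m)⁻¹) = 1 := by
              rw [← MonoidHom.mem_ker, QuotientGroup.ker_mk']
              exact hm
            rw [map_mul, map_inv, map_zpow, mul_inv_eq_one] at h1
            exact h1
          obtain ⟨a, ha⟩ := hz x hx
          obtain ⟨b, hb⟩ := hz y hy
          have h1 : (⁅(⟨x, hx⟩ : s (i+1)), ⟨y, hy⟩⁆) ∈ π.ker := by
            rw [MonoidHom.mem_ker, map_commutatorElement, ha, hb, commutatorElement_eq_one_iff_mul_comm]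
            exact ((Commute.refl _).zpow_zpow a b).eq
          rw [QuotientGroup.ker_mk'] at h1
          exact h1
        have hshift : ∀ j, iterD (s (i+1)) (j+1) ≤ iterD (s i) j := by
          intro j
          induction j with
          | zero => exact hcomm
          | succ j ihj => exact Subgroup.commutator_mono ihj ihj
        exact le_bot_iff.1 (hsol ▸ hshift i)
  obtain ⟨h1, h2⟩ := key k le_rfl
  rw [hk] at h1 h2
  exact ⟨⟨h1⟩, ⟨k, by rw [← iterD_derived]; exact h2⟩⟩

theorem polycyclicByFinite_aux {Γ : Type*} [Group Γ] (h : IsPolycyclicByFinite Γ) :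
    Group.FG Γ ∧ IsSolvableByFinite Γ := by
  obtain ⟨N, hN, hp, hf⟩ := h
  obtain ⟨h1, h2⟩ := polycyclic_aux hp
  refine ⟨?_, N, hN, h2, hf⟩
  rw [Group.fg_iff_subgroup_fg] at h1
  classical
  cases nonempty_fintype (Γ ⧸ N)
  let X : Finset Γ := Finset.univ.image (fun q : Γ ⧸ N => q.out)
  have hX : (Subgroup.closure (X : Set Γ)).FG := ⟨X, rfl⟩
  have : N ⊔ Subgroup.closure (X : Set Γ) = ⊤ := by
    rw [eq_top_iff]
    intro g _
    have h3 : (QuotientGroup.mk g : Γ ⧸ N).out⁻¹ * g ∈ N := by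
      rw [← QuotientGroup.eq]; simp
    have h4 : (QuotientGroup.mk g : Γ ⧸ N).out ∈ Subgroup.closure (X : Set Γ) :=
      Subgroup.subset_closure (by simp [X])
    have := Subgroup.mul_mem _ ((le_sup_right : _ ≤ N ⊔ Subgroup.closure (X : Set Γ)) h4)
      ((le_sup_left : N ≤ N ⊔ Subgroup.closure (X : Set Γ)) h3)
    simpa using this
  exact ⟨this ▸ h1.sup hX⟩

end DM

/-- Let `D` be a division ring, `G` a subnormal subgroup of `Dˣ` and `M` a non-abelian
maximal subgroup of `G`.  Then `M` is not finitely generated solvable-by-finite; in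
particular `M` is not polycyclic-by-finite. -/
theorem maximal_not_fg_solvableByFinite {D : Type*} [DivisionRing D]
    (G M : Subgroup Dˣ) (hG : IsSubnormal G)
    (hmax : M < G ∧ ∀ H : Subgroup Dˣ, M ≤ H → H ≤ G → H = M ∨ H = G)
    (hnonab : ¬ ∀ x ∈ M, ∀ y ∈ M, x * y = y * x) :
    ¬ (Group.FG ↥M ∧ IsSolvableByFinite ↥M) ∧ ¬ IsPolycyclicByFinite ↥M := by
  exact ⟨fun h => DM.part1 G M hG hmax hnonab h.1 h.2, fun h =>
    DM.part1 G M hG hmax hnonab (DM.polycyclicByFinite_aux h).1 (DM.polycyclicByFinite_aux h).2⟩
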